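/- arXiv:2105.14814 — 3 statements merged into one kernel-verified Lean document; each statement's English description precedes it below -/
import Mathlib

section
/- Let m and n be positive integers with m > n, gcd(m,n) = 1 and m ≢ n (mod 2). If m² + n² ≡ 5 (mod 8) and both m + n and m − n are prime numbers, then the only solution in positive integers (x, y, z) of the Diophantine equation x² + (m² − n²)^y = (m² + n²)^z is (x, y, z) = (2mn, 2, 2). -/
/-- The base `1 + 2w(1 - i)`. -/
def stBase (w : ℤ) : GaussianInt := ⟨1 + 2 * w, -2 * w⟩

/-- The linear form `re - 1 + (1+4w) im`. -/
def stF (w : ℤ) (g : GaussianInt) : ℤ := g.re - 1 + (1 + 4 * w) * g.im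

lemma stF_mul (w : ℤ) (g h : GaussianInt) :
    stF w (g * h) = stF w g + stF w h + stF w g * stF w h
      - (1 + (1 + 4 * w) ^ 2) * g.im * h.im := by
  simp only [stF, Zsqrtd.re_mul, Zsqrtd.im_mul]
  ring

lemma im_mul_stF (w : ℤ) (g h : GaussianInt) :
    (g * h).im = g.im + h.im + stF w g * h.im + stF w h * g.im
      - 2 * (1 + 4 * w) * g.im * h.im := by
  simp only [stF, Zsqrtd.im_mul]
  ring

/-- 2-adic control. -/
def stH (w : ℤ) (s : ℕ) (f : ℤ) (g : GaussianInt) : Prop :=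
  (∃ q, g.im = 2 ^ (s + 2) * w * q) ∧ stF w g = 2 ^ (s + 3) * w ^ 2 * f

lemma stH_mul (w : ℤ) (s : ℕ) (f₁ f₂ : ℤ) (g h : GaussianInt)
    (hg : stH w s f₁ g) (hh : stH w s f₂ h) :
    ∃ e : ℤ, stH w s (f₁ + f₂ + 4 * e) (g * h) := by
  obtain ⟨⟨q₁, h1⟩, h2⟩ := hg
  obtain ⟨⟨q₂, h3⟩, h4⟩ := hh
  refine ⟨2 ^ (s + 1) * w ^ 2 * f₁ * f₂ - (1 + 4 * w + 8 * w ^ 2) * 2 ^ s * q₁ * q₂, ⟨?_, ?_⟩⟩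
  · rw [im_mul_stF w, h1, h2, h3, h4]
    refine ⟨q₁ + q₂ + 2 ^ (s + 3) * w ^ 2 * f₁ * q₂ + 2 ^ (s + 3) * w ^ 2 * f₂ * q₁
      - 2 * (1 + 4 * w) * 2 ^ (s + 2) * w * q₁ * q₂, by ring⟩
  · rw [stF_mul, h1, h2, h3, h4]
    ring

lemma stH_pow (w : ℤ) (s : ℕ) (f : ℤ) (g : GaussianInt) (hg : stH w s f g) (r : ℕ) :
    ∃ e : ℤ, stH w s (r * f + 4 * e) (g ^ r) := by
  induction r with
  | zero =>
    refine ⟨0, ⟨0, ?_⟩, ?_⟩ <;> simp [stF]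
  | succ r ih =>
    obtain ⟨e, he⟩ := ih
    obtain ⟨e', he'⟩ := stH_mul w s _ _ _ _ he hg
    refine ⟨e + e', ?_⟩
    rw [pow_succ]
    convert he' using 1
    push_cast
    ring

lemma stH_two_pow (w : ℤ) (s : ℕ) :
    ∃ f : ℤ, Odd f ∧ stH w s f (stBase w ^ 2 ^ (s + 1)) := by
  induction s with
  | zero =>
    refine ⟨-(3 + 4 * w), ⟨-2 * w - 2, by ring⟩, ⟨-(1 + 2 * w), ?_⟩, ?_⟩
    · simp [pow_succ, stBase, Zsqrtd.im_mul]; ring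
    · simp [pow_succ, stBase, stF, Zsqrtd.im_mul]; ring
  | succ s ih =>
    obtain ⟨f, ⟨k, hk⟩, ⟨q, h1⟩, h2⟩ := ih
    rw [show 2 ^ (s + 1 + 1) = 2 ^ (s + 1) + 2 ^ (s + 1) by ring, pow_add]
    generalize stBase w ^ 2 ^ (s + 1) = g at *
    refine ⟨f + 2 ^ (s + 2) * w ^ 2 * f ^ 2 - (1 + 4 * w + 8 * w ^ 2) * 2 ^ (s + 1) * q ^ 2,
      ⟨k + 2 ^ (s + 1) * w ^ 2 * f ^ 2 - (1 + 4 * w + 8 * w ^ 2) * 2 ^ s * q ^ 2, ?_⟩,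
      ⟨q + 2 ^ (s + 3) * w ^ 2 * f * q - (1 + 4 * w) * 2 ^ (s + 2) * w * q ^ 2, ?_⟩, ?_⟩
    · rw [hk]; ring
    · rw [im_mul_stF w, h1, h2]; ring
    · rw [stF_mul, h1, h2]; ring

lemma st_sum_ne (w : ℤ) (hw : w ≠ 0) (n : ℕ) (hn : Odd n) (h3 : 1 < n) :
    (stBase w ^ n).re + (stBase w ^ n).im ≠ 1 ∧ (stBase w ^ n).re + (stBase w ^ n).im ≠ -1 := by
  obtain ⟨N, rfl⟩ : ∃ N, n = N + 1 := ⟨n - 1, by omega⟩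
  have hN : N ≠ 0 := by omega
  obtain ⟨s, r, hr, rfl⟩ := Nat.exists_eq_two_pow_mul_odd hN
  cases s with
  | zero =>
    exfalso
    rw [pow_zero, one_mul] at hn
    exact (Nat.not_odd_iff_even.mpr hr.add_one) hn
  | succ s =>
    obtain ⟨f, hf, hH⟩ := stH_two_pow w s
    obtain ⟨e, -, he⟩ := stH_pow w s f _ hH r
    rw [← pow_mul] at he
    have key : (stBase w ^ (2 ^ (s + 1) * r + 1)).re + (stBase w ^ (2 ^ (s + 1) * r + 1)).im
        = stF w (stBase w ^ (2 ^ (s + 1) * r)) + 1 := by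
      rw [pow_succ]
      simp only [stF, Zsqrtd.re_mul, Zsqrtd.im_mul, stBase]
      ring
    rw [key, he]
    have hodd : Odd ((r : ℤ) * f + 4 * e) := by
      apply Odd.add_even
      · exact Odd.mul (by exact_mod_cast hr) hf
      · exact ⟨2 * e, by ring⟩
    have hne : (r : ℤ) * f + 4 * e ≠ 0 := by
      intro h; rw [h] at hodd; exact absurd hodd (by decide)
    constructor
    · intro h
      have : (2 : ℤ) ^ (s + 3) * w ^ 2 * (r * f + 4 * e) ≠ 0 := by positivity
      apply this; linarith
    · intro h
      have : (2 : ℤ) ^ (s + 3) * w ^ 2 * (r * f + 4 * e)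
        = 8 * (2 ^ s * w ^ 2 * (r * f + 4 * e)) := by ring
      omega

lemma st_diff_ne (w : ℤ) (hw : w ≠ 0) (n : ℕ) (hn : Odd n) :
    (stBase w ^ n).re - (stBase w ^ n).im ≠ 1 ∧ (stBase w ^ n).re - (stBase w ^ n).im ≠ -1 := by
  have key : ∀ n : ℕ, ∃ a b e : ℤ, (stBase w ^ n).re = 1 + 2 * a ∧ (stBase w ^ n).im = 2 * b ∧
      (stBase w ^ n).re - (stBase w ^ n).im = 1 + 4 * n * w + 8 * w * e := by
    intro n
    induction n with
    | zero => exact ⟨0, 0, 0, by simp, by simp, by simp⟩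
    | succ n ih =>
      obtain ⟨a, b, e, h1, h2, h3⟩ := ih
      refine ⟨a + w * (1 + 2 * a) + 2 * w * b, b + 2 * w * b - w * (1 + 2 * a), e + a, ?_, ?_, ?_⟩
      · rw [pow_succ, Zsqrtd.re_mul, h1, h2]; simp only [stBase]; ring
      · rw [pow_succ, Zsqrtd.im_mul, h1, h2]; simp only [stBase]; ring
      · rw [pow_succ, Zsqrtd.im_mul, Zsqrtd.re_mul]
        rw [h1, h2] at *
        simp only [stBase]; push_cast; linear_combination h3
  obtain ⟨a, b, e, -, -, h⟩ := key n
  rw [h]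
  obtain ⟨k, rfl⟩ := hn
  constructor
  · intro h'
    have : w * (2 * (k + e) + 1) = 0 := by push_cast at h'; linarith
    rcases mul_eq_zero.mp this with h0 | h0
    · exact hw h0
    · omega
  · intro h'
    have : 1 + 4 * ((2 * k + 1 : ℕ) : ℤ) * w + 8 * w * e
      = 1 + 4 * (((2 * k + 1 : ℕ) : ℤ) * w + 2 * w * e) := by ring
    omega

lemma gi_dvd (u v : ℤ) (k : ℕ) :
    (u + v ∣ ((⟨u, v⟩ : GaussianInt) ^ (4 * k + 1)).re + ((⟨u, v⟩ : GaussianInt) ^ (4 * k + 1)).im) ∧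
    (u - v ∣ ((⟨u, v⟩ : GaussianInt) ^ (4 * k + 3)).re + ((⟨u, v⟩ : GaussianInt) ^ (4 * k + 3)).im) ∧
    (u - v ∣ ((⟨u, v⟩ : GaussianInt) ^ (4 * k + 1)).re - ((⟨u, v⟩ : GaussianInt) ^ (4 * k + 1)).im) := by
  induction k with
  | zero =>
    refine ⟨by simp, ?_, by simp⟩
    simp [pow_succ]
    exact ⟨u ^ 2 + 4 * u * v + v ^ 2, by ring⟩
  | succ k ih =>
    have e1 : (⟨u, v⟩ : GaussianInt) ^ 4 =
        ⟨(u ^ 2 - v ^ 2) ^ 2 - 4 * u ^ 2 * v ^ 2, 4 * u * v * (u + v) * (u - v)⟩ := by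
      ext <;> simp [pow_succ] <;> ring
    obtain ⟨⟨a, ha⟩, ⟨b, hb⟩, ⟨c, hc⟩⟩ := ih
    rw [show 4 * (k + 1) + 1 = 4 * k + 1 + 4 by ring, show 4 * (k + 1) + 3 = 4 * k + 3 + 4 by ring,
      pow_add _ _ 4, pow_add _ (4 * k + 3) 4, e1]
    generalize (⟨u, v⟩ : GaussianInt) ^ (4 * k + 1) = g at *
    generalize (⟨u, v⟩ : GaussianInt) ^ (4 * k + 3) = h at *
    simp only [Zsqrtd.re_mul, Zsqrtd.im_mul]
    set R := (u ^ 2 - v ^ 2) ^ 2 - 4 * u ^ 2 * v ^ 2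
    refine ⟨⟨R * a + 4 * u * v * (u - v) * (g.re - g.im), ?_⟩,
      ⟨R * b + 4 * u * v * (u + v) * (h.re - h.im), ?_⟩,
      ⟨R * c - 4 * u * v * (u + v) * (g.re + g.im), ?_⟩⟩
    · linear_combination R * ha
    · linear_combination R * hb
    · linear_combination R * hc

lemma gi_unit_root (ε : GaussianIntˣ) (n : ℕ) (hn : Odd n) : ∃ d : GaussianInt, (ε : GaussianInt) = d ^ n := by
  have h1 : (ε : GaussianInt).norm.natAbs = 1 := Zsqrtd.norm_eq_one_iff.mpr ε.isUnit
  have h4 : (ε : GaussianInt) ^ 4 = 1 := by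
    generalize (ε : GaussianInt) = e at h1
    obtain ⟨a, b⟩ := e
    have h2 : a * a + b * b = 1 := by
      have : (Zsqrtd.norm (⟨a, b⟩ : GaussianInt)) = a * a + b * b := by simp [Zsqrtd.norm]
      rw [this] at h1
      have h0 : 0 ≤ a * a + b * b := add_nonneg (mul_self_nonneg a) (mul_self_nonneg b)
      omega
    have ha : -1 ≤ a ∧ a ≤ 1 := by constructor <;> nlinarith
    have hb : -1 ≤ b ∧ b ≤ 1 := by constructor <;> nlinarith
    obtain ⟨ha1, ha2⟩ := ha
    obtain ⟨hb1, hb2⟩ := hb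
    interval_cases a <;> interval_cases b <;> first | omega | (ext <;> simp [pow_succ])
  refine ⟨(ε : GaussianInt) ^ n, ?_⟩
  rw [← pow_mul]
  obtain ⟨k, rfl⟩ := hn
  rw [show (2 * k + 1) * (2 * k + 1) = 4 * (k ^ 2 + k) + 1 by ring, pow_succ, pow_mul, h4]
  simp

lemma st_factor (k : ℤ) (c : ℕ) (n : ℕ) (hn : Odd n) (h : 2 * k ^ 2 + 2 * k + 1 = (c : ℤ) ^ n) :
    ∃ d : GaussianInt, d ^ n = ⟨k + 1, -k⟩ := by
  have hcop : IsCoprime (⟨k + 1, -k⟩ : GaussianInt) ⟨k + 1, k⟩ := by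
    refine ⟨⟨k + 1, k⟩ - ⟨k ^ 2 + k, 0⟩ * (1 - ⟨0, 1⟩), - ⟨k ^ 2 + k, 0⟩ * (1 + ⟨0, 1⟩), ?_⟩
    ext <;> simp <;> ring
  have hmul : (⟨k + 1, -k⟩ : GaussianInt) * ⟨k + 1, k⟩ = (c : GaussianInt) ^ n := by
    have : (c : GaussianInt) ^ n = (((c : ℤ) ^ n : ℤ) : GaussianInt) := by push_cast; rfl
    rw [this, ← h]
    ext
    · rw [Zsqrtd.re_intCast]; simp; ring
    · rw [Zsqrtd.im_intCast]; simp; ring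
  obtain ⟨d, ε, hd⟩ := exists_associated_pow_of_mul_eq_pow' hcop hmul
  obtain ⟨d', hd'⟩ := gi_unit_root ε n hn
  exact ⟨d * d', by rw [mul_pow, ← hd', hd]⟩

lemma gi_star_pow (d : GaussianInt) (n : ℕ) : (star d) ^ n = star (d ^ n) := (star_pow d n).symm

lemma gi_I_pow_one (k : ℕ) : (⟨0, 1⟩ : GaussianInt) ^ (4 * k + 1) = ⟨0, 1⟩ := by
  have : (⟨0, 1⟩ : GaussianInt) ^ 4 = 1 := by ext <;> simp [pow_succ]
  rw [pow_succ, pow_mul, this]; simp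

lemma gi_I_pow_three (k : ℕ) : (⟨0, 1⟩ : GaussianInt) ^ (4 * k + 3) = ⟨0, -1⟩ := by
  rw [show 4 * k + 3 = 4 * k + 1 + 2 by ring, pow_add, gi_I_pow_one]
  ext <;> simp [pow_succ]

lemma odd_unit_pow (ε : ℤ) (hε : ε = 1 ∨ ε = -1) (n : ℕ) (hn : Odd n) :
    ((ε : ℤ) : GaussianInt) ^ n = ((ε : ℤ) : GaussianInt) := by
  rcases hε with rfl | rfl
  · simp
  · simp [hn.neg_one_pow]

/-- Størmer: `x² + 1 = 2 cⁿ` has no solution with `n > 1` odd and `c > 1`. -/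
lemma stormer (x c n : ℕ) (hn : Odd n) (h1 : 1 < n) (hc : 1 < c) (h : x ^ 2 + 1 = 2 * c ^ n) :
    False := by
  have hxodd : Odd x := by
    by_contra hx
    obtain ⟨j, rfl⟩ := Nat.not_odd_iff_even.mp hx
    have : (j + j) ^ 2 = 2 * (2 * j ^ 2) := by ring
    omega
  obtain ⟨k, rfl⟩ := hxodd
  have hk : 2 * (k : ℤ) ^ 2 + 2 * k + 1 = (c : ℤ) ^ n := by
    have : ((2 * k + 1 : ℤ)) ^ 2 + 1 = 2 * (c : ℤ) ^ n := by exact_mod_cast h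
    linarith
  obtain ⟨⟨u, v⟩, hd⟩ := st_factor k c n hn hk
  have hsum : ((⟨u, v⟩ : GaussianInt) ^ n).re + ((⟨u, v⟩ : GaussianInt) ^ n).im = 1 := by
    rw [hd]; simp
  -- the norm
  have hnorm : u ^ 2 + v ^ 2 ≠ 1 := by
    intro h2
    have e1 : Zsqrtd.norm ((⟨u, v⟩ : GaussianInt) ^ n) = (u ^ 2 + v ^ 2) ^ n := by
      have e0 : Zsqrtd.norm ((⟨u, v⟩ : GaussianInt) ^ n) = (Zsqrtd.norm (⟨u, v⟩ : GaussianInt)) ^ n :=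
        map_pow (Zsqrtd.normMonoidHom (d := -1)) _ n
      rw [e0]
      congr 1
      simp [Zsqrtd.norm]; ring
    rw [hd, h2, one_pow] at e1
    have e2 : (c : ℤ) ^ n = 1 := by
      simp [Zsqrtd.norm] at e1; rw [← hk]; linarith
    have e3 : 1 < (c : ℤ) ^ n := one_lt_pow₀ (by exact_mod_cast hc) (by omega)
    omega
  have hn4 : (∃ j, n = 4 * j + 1) ∨ (∃ j, n = 4 * j + 3) := by
    obtain ⟨i, rfl⟩ := hn
    rcases Nat.even_or_odd' i with ⟨j, rfl | rfl⟩
    · exact Or.inl ⟨j, by ring⟩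
    · exact Or.inr ⟨j, by ring⟩
  rcases hn4 with ⟨j, hj⟩ | ⟨j, hj⟩
  · have hdv := (gi_dvd u v j).1
    rw [← hj, hsum] at hdv
    have hε : u + v = 1 ∨ u + v = -1 := Int.isUnit_iff.mp (isUnit_of_dvd_one hdv)
    have hpow := odd_unit_pow (u + v) hε n hn
    rcases Int.even_or_odd' v with ⟨w, hw | hw⟩
    · -- `v` even
      obtain ⟨W, hW⟩ : ∃ W, W = -(u + v) * w := ⟨_, rfl⟩
      have hW0 : W ≠ 0 := by
        rintro rfl
        apply hnorm
        rcases hε with h' | h' <;> rw [h'] at hW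
        · have hv0 : v = 0 := by omega
          have hu0 : u = 1 := by omega
          rw [hu0, hv0]; norm_num
        · have hv0 : v = 0 := by omega
          have hu0 : u = -1 := by omega
          rw [hu0, hv0]; norm_num
      have hB : (⟨u, v⟩ : GaussianInt) = ((u + v : ℤ) : GaussianInt) * stBase W := by
        rcases hε with h' | h' <;> rw [h'] at hW ⊢ <;> ext <;> simp [stBase] <;> omega
      have hs := st_sum_ne W hW0 n hn h1
      rw [hB, mul_pow, hpow] at hsum
      generalize stBase W ^ n = g at *
      rcases hε with h' | h' <;> rw [h'] at hsum <;> simp at hsum <;> omega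
    · obtain ⟨W, hW⟩ : ∃ W, 2 * W = (u + v) * (-u) := by
        rcases hε with h' | h' <;> rw [h']
        · exact ⟨w, by omega⟩
        · exact ⟨-w-1, by omega⟩
      have hW0 : W ≠ 0 := by
        rintro rfl
        apply hnorm
        rcases hε with h' | h' <;> rw [h'] at hW
        · have hu0 : u = 0 := by omega
          have hv0 : v = 1 := by omega
          rw [hu0, hv0]; norm_num
        · have hu0 : u = 0 := by omega
          have hv0 : v = -1 := by omega
          rw [hu0, hv0]; norm_num
      have hB : (⟨u, v⟩ : GaussianInt) = ((u + v : ℤ) : GaussianInt) * (⟨0, 1⟩ * star (stBase W)) := by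
        rcases hε with h' | h' <;> rw [h'] at hW ⊢ <;> ext <;> simp [stBase] <;> omega
      have hs := st_sum_ne W hW0 n hn h1
      rw [hB, mul_pow, hpow, mul_pow, gi_star_pow, hj, gi_I_pow_one, ← hj] at hsum
      generalize stBase W ^ n = g at *
      rcases hε with h' | h' <;> rw [h'] at hsum <;> simp at hsum <;> omega
  · have hdv := (gi_dvd u v j).2.1
    rw [← hj, hsum] at hdv
    have hε : u - v = 1 ∨ u - v = -1 := Int.isUnit_iff.mp (isUnit_of_dvd_one hdv)
    have hpow := odd_unit_pow (u - v) hε n hn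
    rcases Int.even_or_odd' v with ⟨w, hw | hw⟩
    · -- `v` even
      obtain ⟨W, hW⟩ : ∃ W, W = (u - v) * w := ⟨_, rfl⟩
      have hW0 : W ≠ 0 := by
        rintro rfl
        apply hnorm
        rcases hε with h' | h' <;> rw [h'] at hW
        · have hv0 : v = 0 := by omega
          have hu0 : u = 1 := by omega
          rw [hu0, hv0]; norm_num
        · have hv0 : v = 0 := by omega
          have hu0 : u = -1 := by omega
          rw [hu0, hv0]; norm_num
      have hB : (⟨u, v⟩ : GaussianInt) = ((u - v : ℤ) : GaussianInt) * star (stBase W) := by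
        rcases hε with h' | h' <;> rw [h'] at hW ⊢ <;> ext <;> simp [stBase] <;> omega
      have hs := st_diff_ne W hW0 n hn
      rw [hB, mul_pow, hpow, gi_star_pow] at hsum
      generalize stBase W ^ n = g at *
      rcases hε with h' | h' <;> rw [h'] at hsum <;> simp at hsum <;> omega
    · obtain ⟨W, hW⟩ : ∃ W, 2 * W = (u - v) * (-u) := by
        rcases hε with h' | h' <;> rw [h']
        · exact ⟨-w-1, by omega⟩
        · exact ⟨w, by omega⟩
      have hW0 : W ≠ 0 := by
        rintro rfl
        apply hnorm
        rcases hε with h' | h' <;> rw [h'] at hW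
        · have hu0 : u = 0 := by omega
          have hv0 : v = -1 := by omega
          rw [hu0, hv0]; norm_num
        · have hu0 : u = 0 := by omega
          have hv0 : v = 1 := by omega
          rw [hu0, hv0]; norm_num
      have hB : (⟨u, v⟩ : GaussianInt) = ((-(u - v) : ℤ) : GaussianInt) * (⟨0, 1⟩ * stBase W) := by
        rcases hε with h' | h' <;> rw [h'] at hW ⊢ <;> ext <;> simp [stBase] <;> omega
      have hpow' := odd_unit_pow (-(u - v)) (by omega) n hn
      have hs := st_diff_ne W hW0 n hn
      rw [hB, mul_pow, hpow', mul_pow, hj, gi_I_pow_three, ← hj] at hsum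
      generalize stBase W ^ n = g at *
      rcases hε with h' | h' <;> rw [h'] at hsum <;> simp at hsum <;> omega

open scoped NumberTheorySymbols in
lemma jac_neg (c r s : ℕ) (hr : r % 8 = 3 ∨ r % 8 = 5) (hrs : Nat.Coprime s r)
    (h : 2 * c = r ^ 2 + s ^ 2) : J((c : ℤ) | r) = -1 := by
  have hodd : Odd r := Nat.odd_iff.mpr (by omega)
  have h2 : J(2 | r) = -1 := by
    rw [jacobiSym.at_two hodd, ZMod.χ₈_nat_eq_if_mod_eight]
    rcases hr with h | h <;> simp [h] <;> omega
  have h3 : J(((2 * c : ℕ) : ℤ) | r) = J((s : ℤ) ^ 2 | r) := by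
    apply jacobiSym.mod_left'
    rw [h]; push_cast
    rw [pow_two (r : ℤ)]
    simp
  rw [jacobiSym.sq_one' (by simpa using hrs)] at h3
  push_cast at h3
  rw [jacobiSym.mul_left, h2] at h3
  linarith

open scoped NumberTheorySymbols in
lemma z_even (c r s x y z : ℕ) (hr : r % 8 = 3 ∨ r % 8 = 5) (hrs : Nat.Coprime s r)
    (h : 2 * c = r ^ 2 + s ^ 2) (hy : 0 < y) (heq : x ^ 2 + (r * s) ^ y = c ^ z) : Even z := by
  have h1 := jac_neg c r s hr hrs h
  by_contra hz
  have hz := Nat.not_even_iff_odd.mp hz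
  have h3 : J(((c ^ z : ℕ) : ℤ) | r) = J((x : ℤ) ^ 2 | r) := by
    apply jacobiSym.mod_left'
    rw [← heq]; push_cast
    obtain ⟨k, rfl⟩ : ∃ k, y = k + 1 := ⟨y - 1, by omega⟩
    rw [pow_succ _ k, show ((r : ℤ) * s) ^ k * (r * s) = r * ((r * s) ^ k * s) by ring]
    simp
  push_cast at h3
  rw [jacobiSym.pow_left, jacobiSym.pow_left, h1, hz.neg_one_pow] at h3
  have := sq_nonneg (J((x : ℤ) | r))
  omega

open scoped NumberTheorySymbols in
lemma Z_odd (c r s y z : ℕ) (hr : r % 8 = 3 ∨ r % 8 = 5) (hrs : Nat.Coprime s r)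
    (h : 2 * c = r ^ 2 + s ^ 2) (hy : 0 < y) (heq : 1 + (r * s) ^ y = 2 * c ^ z) : Odd z := by
  have h1 := jac_neg c r s hr hrs h
  have hodd : Odd r := Nat.odd_iff.mpr (by omega)
  have h2 : J(2 | r) = -1 := by
    rw [jacobiSym.at_two hodd, ZMod.χ₈_nat_eq_if_mod_eight]
    rcases hr with h | h <;> simp [h] <;> omega
  by_contra hz
  have hz := Nat.not_odd_iff_even.mp hz
  have h3 : J(((2 * c ^ z : ℕ) : ℤ) | r) = J(1 | r) := by
    apply jacobiSym.mod_left'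
    rw [← heq]; push_cast
    obtain ⟨k, rfl⟩ : ∃ k, y = k + 1 := ⟨y - 1, by omega⟩
    rw [pow_succ _ k, show ((r : ℤ) * s) ^ k * (r * s) = r * ((r * s) ^ k * s) by ring]
    simp
  push_cast at h3
  rw [jacobiSym.mul_left, jacobiSym.pow_left, h1, h2, hz.neg_one_pow, jacobiSym.one_left] at h3
  omega

open scoped NumberTheorySymbols in
lemma y_even (b c m x y z : ℕ) (hc : c % 8 = 5) (hb : b + c = 2 * m ^ 2) (hmc : Nat.Coprime m c)
    (hz : 0 < z) (heq : x ^ 2 + b ^ y = c ^ z) : Even y := by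
  have hodd : Odd c := Nat.odd_iff.mpr (by omega)
  have h2 : J(2 | c) = -1 := by
    rw [jacobiSym.at_two hodd, ZMod.χ₈_nat_eq_if_mod_eight]
    simp [hc]; omega
  have h4 : J(-1 | c) = 1 := by
    rw [jacobiSym.at_neg_one hodd, ZMod.χ₄_nat_one_mod_four (by omega)]
  have hbJ : J((b : ℤ) | c) = -1 := by
    have : J((b : ℤ) | c) = J(2 * (m : ℤ) ^ 2 | c) := by
      apply jacobiSym.mod_left'
      have : (2 * (m : ℤ) ^ 2) = b + c := by exact_mod_cast hb.symm
      rw [this]; simp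
    rw [this, jacobiSym.mul_left, h2, jacobiSym.sq_one' (by simpa using hmc)]
    norm_num
  by_contra hy
  have hy := Nat.not_even_iff_odd.mp hy
  have h3 : J((x : ℤ) ^ 2 | c) = J(-1 * (b : ℤ) ^ y | c) := by
    apply jacobiSym.mod_left'
    have : (x : ℤ) ^ 2 = -1 * (b : ℤ) ^ y + c ^ z := by
      have : (x : ℤ) ^ 2 + b ^ y = c ^ z := by exact_mod_cast heq
      linarith
    rw [this]
    obtain ⟨k, rfl⟩ : ∃ k, z = k + 1 := ⟨z - 1, by omega⟩
    rw [pow_succ]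
    simp
  rw [jacobiSym.mul_left, jacobiSym.pow_left, jacobiSym.pow_left, h4, hbJ, hy.neg_one_pow] at h3
  have := sq_nonneg (J((x : ℤ) | c))
  omega

lemma caseB (P Q c Y Z : ℕ) (hQ : 1 < Q) (hPQ : Q < P) (hcop : Nat.Coprime P Q) (hc : Odd c)
    (h2c : P + Q = 2 * c) (hY : Odd Y) (hZ : 0 < Z) (h : P ^ Y + Q ^ Y = 2 * c ^ Z) : Y = 1 := by
  obtain ⟨k, rfl⟩ : ∃ k, Z = k + 1 := ⟨Z - 1, by omega⟩
  have h' : P ^ Y + Q ^ Y = (P + Q) * c ^ k := by rw [h, h2c]; ring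
  have hdvd : c ^ k ∣ Y := by
    rw [Nat.dvd_iff_prime_pow_dvd_dvd]
    intro r j hr hj
    rcases Nat.eq_zero_or_pos j with rfl | hj0
    · simp
    have hrc : r ∣ c := hr.dvd_of_dvd_pow ((dvd_pow_self r hj0.ne').trans hj)
    have hrodd : Odd r := hc.of_dvd_nat hrc
    have hrPQ : r ∣ P + Q := by rw [h2c]; exact hrc.mul_left 2
    have hrP : ¬ r ∣ P := by
      intro hP
      have hQ' : r ∣ Q := (Nat.dvd_add_right hP).mp hrPQ
      have := Nat.dvd_gcd hP hQ'
      rw [hcop] at this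
      exact hr.one_lt.ne' (Nat.dvd_one.mp this)
    have key := Nat.emultiplicity_pow_add_pow hr hrodd hrPQ hrP hY
    rw [h', emultiplicity_mul hr.prime] at key
    have hfin : emultiplicity r (P + Q) ≠ ⊤ := by
      apply finiteMultiplicity_iff_emultiplicity_ne_top.mp
      exact Nat.finiteMultiplicity_iff.mpr ⟨hr.ne_one, by omega⟩
    have key2 : emultiplicity r (c ^ k) = emultiplicity r Y := by
      exact ENat.add_right_injective_of_ne_top hfin key
    rw [pow_dvd_iff_le_emultiplicity, ← key2, ← pow_dvd_iff_le_emultiplicity]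
    exact hj
  have hle : c ^ k ≤ Y := Nat.le_of_dvd hY.pos hdvd
  by_contra hne
  obtain ⟨t, rfl⟩ : ∃ t, Y = t + 1 := ⟨Y - 1, by have := hY.pos; omega⟩
  have ht : t ≠ 0 := by omega
  have h1 : t < Q ^ t := Nat.lt_pow_self hQ
  have h2 : Q ^ t < P ^ t := Nat.pow_lt_pow_left hPQ ht
  have h3 : P ^ (t + 1) + Q ^ (t + 1) ≤ (P + Q) * (t + 1) := by rw [h']; gcongr
  rw [pow_succ, pow_succ] at h3
  nlinarith

lemma prime_pow_split (p A B y : ℕ) (hp : p.Prime) (hAB : Nat.Coprime A B) (h : p ^ y ∣ A * B) :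
    p ^ y ∣ A ∨ p ^ y ∣ B := by
  by_cases hA : p ∣ A
  · left
    have : Nat.Coprime p B := Nat.Coprime.coprime_dvd_left hA hAB
    exact (Nat.Coprime.pow_left y this).dvd_of_dvd_mul_right h
  · right
    have : Nat.Coprime p A := (Nat.Prime.coprime_iff_not_dvd hp).mpr hA
    exact (Nat.Coprime.pow_left y this).dvd_of_dvd_mul_left h

lemma mod8 (n q : ℕ) (h : ((n + q) ^ 2 + n ^ 2) % 8 = 5) :
    ((2 * n + q) % 8 = 3 ∨ (2 * n + q) % 8 = 5) ∨ (q % 8 = 3 ∨ q % 8 = 5) := by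
  have key : ∀ a b : ZMod 8, (a + b) ^ 2 + a ^ 2 = 5 →
    ((2 * a + b = 3 ∨ 2 * a + b = 5) ∨ (b = 3 ∨ b = 5)) := by decide
  have conv : ∀ a k : ℕ, k < 8 → ((a : ZMod 8) = (k : ZMod 8) ↔ a % 8 = k) := by
    intro a k hk
    rw [ZMod.natCast_eq_natCast_iff', Nat.mod_eq_of_lt hk]
  have := key n q (by
    have := (conv _ 5 (by norm_num)).mpr h
    push_cast at this
    exact this)
  rw [← conv _ 3 (by norm_num), ← conv _ 5 (by norm_num), ← conv _ 3 (by norm_num),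
    ← conv _ 5 (by norm_num)]
  push_cast
  exact this

set_option maxHeartbeats 1000000 in
/-- Terai's conjecture for primitive Pythagorean triples `(2mn, m²-n², m²+n²)` with
`m² + n² ≡ 5 (mod 8)` and both `m+n` and `m-n` prime: the only positive integer
solution of `x² + (m²-n²)^y = (m²+n²)^z` is `(x, y, z) = (2mn, 2, 2)`. -/
theorem terai_conjecture_two_prime_case
    (m n : ℕ) (hm : 0 < m) (hn : 0 < n) (hmn : n < m)
    (hgcd : Nat.gcd m n = 1) (hpar : m % 2 ≠ n % 2)
    (hmod : (m ^ 2 + n ^ 2) % 8 = 5)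
    (hp : Nat.Prime (m + n)) (hq : Nat.Prime (m - n))
    (x y z : ℕ) (hx : 0 < x) (hy : 0 < y) (hz : 0 < z)
    (heq : x ^ 2 + (m ^ 2 - n ^ 2) ^ y = (m ^ 2 + n ^ 2) ^ z) :
    x = 2 * m * n ∧ y = 2 ∧ z = 2 := by
  obtain ⟨q, rfl⟩ : ∃ q, m = n + q := ⟨m - n, by omega⟩
  rw [show n + q - n = q by omega] at hq
  rw [show n + q + n = 2 * n + q by ring] at hp
  have hb : (n + q) ^ 2 - n ^ 2 = (2 * n + q) * q := by
    rw [show (n + q) ^ 2 = (2 * n + q) * q + n ^ 2 by ring]; simp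
  rw [hb] at heq
  have hm8 := mod8 n q hmod
  obtain ⟨p, hpdef⟩ : ∃ p, p = 2 * n + q := ⟨_, rfl⟩
  obtain ⟨c, hcdef⟩ : ∃ c, c = (n + q) ^ 2 + n ^ 2 := ⟨_, rfl⟩
  rw [← hpdef] at hp heq hm8
  rw [← hcdef] at heq hmod
  have hqp : q < p := by omega
  have hcop : Nat.Coprime p q := (Nat.coprime_primes hp hq).mpr (by omega)
  have h2c : 2 * c = p ^ 2 + q ^ 2 := by rw [hcdef, hpdef]; ring
  have h2c' : 2 * c = q ^ 2 + p ^ 2 := by rw [h2c]; ring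
  have hcodd : Odd c := Nat.odd_iff.mpr (by omega)
  have hq2 := hq.two_le
  have hc1 : 1 < c := by nlinarith
  -- parity of `z` and `y`
  have hze : Even z := by
    rcases hm8 with h | h
    · exact z_even c p q x y z h hcop.symm h2c hy heq
    · exact z_even c q p x y z h hcop h2c' hy (by rw [mul_comm q p]; exact heq)
  have hye : Even y := by
    refine y_even (p * q) c (n + q) x y z hmod ?_ ?_ hz heq
    · rw [hcdef, hpdef]; ring
    · rw [hcdef, pow_two (n + q), Nat.coprime_mul_right_add_right]
      exact Nat.Coprime.pow_right 2 hgcd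
  obtain ⟨Z, rfl⟩ := hze
  obtain ⟨Y, rfl⟩ := hye
  have hZ : 0 < Z := by omega
  have hY : 0 < Y := by omega
  -- the factorization
  have hxlt : x < c ^ Z := by
    have : 0 < (p * q) ^ (Y + Y) := by have := hp.pos; positivity
    have h1 : x ^ 2 < (c ^ Z) ^ 2 := by
      rw [← pow_mul, mul_two]; omega
    exact lt_of_pow_lt_pow_left₀ 2 (Nat.zero_le _) h1
  obtain ⟨A, hA⟩ : ∃ A, c ^ Z = A + x := ⟨c ^ Z - x, by omega⟩
  have hA0 : 0 < A := by omega
  have hprod : A * (A + 2 * x) = (p * q) ^ (Y + Y) := by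
    have : c ^ (Z + Z) = (A + x) ^ 2 := by rw [← hA]; ring
    rw [this] at heq
    nlinarith
  obtain ⟨B, hB⟩ : ∃ B, B = A + 2 * x := ⟨_, rfl⟩
  rw [← hB] at hprod
  have hAB : A + B = 2 * c ^ Z := by omega
  have hbc : Nat.Coprime (p * q) (2 * c) := by
    apply Nat.Coprime.mul_left
    · rw [h2c, pow_two p, Nat.coprime_mul_right_add_right]
      exact Nat.Coprime.pow_right 2 hcop
    · rw [h2c', pow_two q, Nat.coprime_mul_right_add_right]
      exact Nat.Coprime.pow_right 2 hcop.symm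
  have hcopAB : Nat.Coprime A B := by
    apply Nat.coprime_of_dvd
    intro r hr hrA hrB
    have h1 : r ∣ p * q := hr.dvd_of_dvd_pow (n := Y + Y) (by rw [← hprod]; exact hrA.mul_right B)
    have h2 : r ∣ 2 * c := by
      have h3 : r ∣ 2 * c ^ Z := by rw [← hAB]; exact dvd_add hrA hrB
      rcases (Nat.Prime.dvd_mul hr).mp h3 with h | h
      · exact h.mul_right c
      · exact (hr.dvd_of_dvd_pow h).mul_left 2
    have := Nat.dvd_gcd h1 h2
    rw [hbc] at this
    exact hr.one_lt.ne' (Nat.dvd_one.mp this)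
  have hp0 := hp.pos
  have hpd := prime_pow_split p A B (Y + Y) hp hcopAB
    (by rw [hprod, mul_pow]; exact dvd_mul_right _ _)
  have hqd := prime_pow_split q A B (Y + Y) hq hcopAB
    (by rw [hprod, mul_pow]; exact dvd_mul_left _ _)
  have hpqc : Nat.Coprime (p ^ (Y + Y)) (q ^ (Y + Y)) := Nat.Coprime.pow _ _ hcop
  have hPpos : 0 < p ^ (Y + Y) := by positivity
  have hQpos : 0 < q ^ (Y + Y) := by positivity
  have hlt : q ^ (Y + Y) < p ^ (Y + Y) := Nat.pow_lt_pow_left hqp (by omega)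
  rw [mul_pow] at hprod
  rcases hpd with hpA | hpB
  · exfalso
    rcases hqd with hqA | hqB
    · have h1 := Nat.le_of_dvd hA0 (hpqc.mul_dvd_of_dvd_of_dvd hpA hqA)
      rw [← hprod] at h1
      have h2 : B ≤ 1 := Nat.le_of_mul_le_mul_left (by rw [mul_one]; exact h1) hA0
      omega
    · have h1 := Nat.le_of_dvd hA0 hpA
      obtain ⟨a, ha⟩ := hpA
      obtain ⟨b, hb'⟩ := hqB
      have h2 : a * b = 1 := by
        have : (p ^ (Y + Y) * q ^ (Y + Y)) * (a * b) = (p ^ (Y + Y) * q ^ (Y + Y)) * 1 := by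
          rw [mul_one]
          refine Eq.trans ?_ hprod
          rw [ha, hb']; ring
        exact Nat.eq_of_mul_eq_mul_left (by positivity) this
      have hb1 : b = 1 := Nat.eq_one_of_mul_eq_one_left h2
      rw [hb1] at hb'
      omega
  · rcases hqd with hqA | hqB
    · obtain ⟨a, ha⟩ := hqA
      obtain ⟨b, hb'⟩ := hpB
      have h2 : a * b = 1 := by
        have : (p ^ (Y + Y) * q ^ (Y + Y)) * (a * b) = (p ^ (Y + Y) * q ^ (Y + Y)) * 1 := by
          rw [mul_one]
          refine Eq.trans ?_ hprod
          rw [ha, hb']; ring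
        exact Nat.eq_of_mul_eq_mul_left (by positivity) this
      have hb1 : b = 1 := Nat.eq_one_of_mul_eq_one_left h2
      have ha1 : a = 1 := Nat.eq_one_of_mul_eq_one_right h2
      rw [hb1, mul_one] at hb'
      rw [ha1, mul_one] at ha
      have hsum : (p ^ 2) ^ Y + (q ^ 2) ^ Y = 2 * c ^ Z := by
        rw [← hAB, ha, hb', ← pow_mul, ← pow_mul, two_mul]; ring
      have hcop2 : Nat.Coprime (p ^ 2) (q ^ 2) := Nat.Coprime.pow 2 2 hcop
      have hYodd : Odd Y := by
        by_contra hYe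
        have hYe := Nat.not_odd_iff_even.mp hYe
        have hd1 : (c : ℤ) ∣ (p ^ 2 : ℤ) ^ Y - (-(q ^ 2 : ℤ)) ^ Y := by
          refine dvd_trans ?_ (sub_dvd_pow_sub_pow _ _ Y)
          refine ⟨2, ?_⟩
          have : (2 * c : ℤ) = p ^ 2 + q ^ 2 := by exact_mod_cast h2c
          linarith
        rw [hYe.neg_pow] at hd1
        have hd2 : (c : ℤ) ∣ (p ^ 2 : ℤ) ^ Y + (q ^ 2 : ℤ) ^ Y := by
          have : (p ^ 2 : ℤ) ^ Y + (q ^ 2 : ℤ) ^ Y = 2 * c ^ Z := by exact_mod_cast hsum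
          rw [this]
          exact (dvd_pow_self _ hZ.ne').mul_left 2
        have hd3 : (c : ℤ) ∣ ((2 * (p ^ 2) ^ Y : ℕ) : ℤ) := by
          have h5 := dvd_add hd1 hd2
          have h6 : ((2 * (p ^ 2) ^ Y : ℕ) : ℤ) = (p ^ 2 : ℤ) ^ Y - (q ^ 2 : ℤ) ^ Y
              + ((p ^ 2 : ℤ) ^ Y + (q ^ 2 : ℤ) ^ Y) := by
            push_cast; ring
          rw [h6]
          exact h5
        have hd4 : c ∣ 2 * (p ^ 2) ^ Y := by exact_mod_cast hd3
        have hcp : Nat.Coprime c (2 * (p ^ 2) ^ Y) := by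
          apply Nat.Coprime.mul_right
          · exact (Nat.coprime_two_right).mpr hcodd
          · apply Nat.Coprime.pow_right
            apply Nat.Coprime.pow_right
            exact (hbc.coprime_mul_right.coprime_mul_left_right).symm
        have := Nat.Coprime.eq_one_of_dvd hcp hd4
        omega
      have hY1 : Y = 1 := caseB (p ^ 2) (q ^ 2) c Y Z (Nat.one_lt_pow (by norm_num) hq.one_lt)
        (Nat.pow_lt_pow_left hqp (by norm_num)) hcop2 hcodd h2c.symm hYodd hZ hsum
      subst hY1
      have hZ1 : Z = 1 := by
        have : c ^ Z = c ^ 1 := by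
          rw [pow_one, pow_one, ← h2c] at hsum
          rw [pow_one]
          omega
        exact Nat.pow_right_injective hc1 this
      subst hZ1
      refine ⟨?_, rfl, rfl⟩
      have e1 : 2 * x + q ^ 2 = p ^ 2 := by
        simp only [Nat.reduceAdd] at ha hb'
        omega
      rw [hpdef] at e1
      nlinarith
    · exfalso
      have hB0 : 0 < B := by omega
      have h1 := Nat.le_of_dvd hB0 (hpqc.mul_dvd_of_dvd_of_dvd hpB hqB)
      have hA1 : A = 1 := by
        rw [← hprod] at h1
        have h2 : A ≤ 1 := Nat.le_of_mul_le_mul_right (by rw [one_mul]; exact h1) hB0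
        omega
      rw [hA1, one_mul] at hprod
      have hE : 1 + (p * q) ^ (Y + Y) = 2 * c ^ Z := by
        rw [mul_pow, ← hprod, ← hAB, hA1]
      have hZodd : Odd Z := by
        rcases hm8 with h | h
        · exact Z_odd c p q (Y + Y) Z h hcop.symm h2c (by omega) hE
        · exact Z_odd c q p (Y + Y) Z h hcop h2c' (by omega) (by rw [mul_comm q p]; exact hE)
      rcases Nat.eq_or_lt_of_le (Nat.succ_le_of_lt hZ) with h | h
      · rw [← h, Nat.succ_eq_add_one, zero_add, pow_one, h2c] at hE
        have h3 : (p * q) ^ 2 ≤ (p * q) ^ (Y + Y) :=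
          Nat.pow_le_pow_right (by positivity) (by omega)
        have h4 : 4 ≤ q ^ 2 := by nlinarith
        have h5 : 4 ≤ p ^ 2 := by nlinarith
        have h6 : (p * q) ^ 2 = p ^ 2 * q ^ 2 := by ring
        nlinarith
      · refine stormer ((p * q) ^ Y) c Z hZodd h hc1 ?_
        rw [← hE]; ring
end

section
/- If q ≥ 3 is an odd integer, then the equation y^q = a² + (a+1)² has no solutions in positive integers y and a. -/
/-- `z = 1 + 2Nc(X + iY)` with `2(X + sY) = c(n + 2e)`. -/
def Good (s c N n : ℤ) (z : GaussianInt) : Prop :=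
  ∃ X Y e : ℤ, z = ⟨1 + 2 * N * c * X, 2 * N * c * Y⟩ ∧ 2 * (X + s * Y) = c * (n + 2 * e)

lemma Good.mul {s c N n n' : ℤ} {z z' : GaussianInt} (h : Good s c N n z) (h' : Good s c N n' z') :
    Good s c N (n + n') (z * z') := by
  obtain ⟨X, Y, e, rfl, h⟩ := h
  obtain ⟨X', Y', e', rfl, h'⟩ := h'
  refine ⟨X + X' + 2 * N * c * (X * X' - Y * Y'), Y + Y' + 2 * N * c * (X * Y' + X' * Y),
    e + e' + 2 * N * (X * X' - Y * Y') + 2 * N * s * (X * Y' + X' * Y), ?_, ?_⟩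
  · ext <;> simp [Zsqrtd.re_mul, Zsqrtd.im_mul] <;> ring
  · linear_combination h + h'

lemma Good.sq {s c N : ℤ} {z : GaussianInt} (h : Good s c N 1 z) : Good s c (2 * N) 1 (z ^ 2) := by
  obtain ⟨X, Y, e, rfl, h⟩ := h
  refine ⟨X + N * c * (X ^ 2 - Y ^ 2), Y + 2 * N * c * X * Y,
    e + N * (X ^ 2 - Y ^ 2) + 2 * s * N * X * Y, ?_, ?_⟩
  · rw [pow_two]
    ext <;> simp [Zsqrtd.re_mul, Zsqrtd.im_mul] <;> ring
  · linear_combination h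

lemma Good.pow {s c N : ℤ} {z : GaussianInt} (h : Good s c N 1 z) (l : ℕ) :
    Good s c N l (z ^ l) := by
  induction l with
  | zero => exact ⟨0, 0, 0, by ext <;> simp, by simp⟩
  | succ l ih =>
    rw [pow_succ]
    push_cast
    exact ih.mul h

lemma Good.pow_two_pow {s c : ℤ} {z : GaussianInt} (h : Good s c 1 1 z) (r : ℕ) :
    Good s c (2 ^ r) 1 (z ^ (2 ^ r)) := by
  induction r with
  | zero => simpa using h
  | succ r ih =>
    have := ih.sq
    rw [← pow_mul, ← pow_succ, ← pow_succ'] at this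
    exact this

lemma base_good {s c : ℤ} (hs : s ^ 2 = 2 * c + 1) (hc : 4 ∣ c) :
    Good s c 1 1 (-(⟨c, s⟩ : GaussianInt) ^ 2) := by
  obtain ⟨d, rfl⟩ := hc
  refine ⟨1 - 2 * d, -s, -3, ?_, ?_⟩
  · rw [pow_two]
    ext <;> simp [Zsqrtd.re_mul, Zsqrtd.im_mul]
    · linear_combination hs
    · ring
  · linear_combination -2 * hs

lemma core_even {s c : ℤ} (hs : s ^ 2 = 2 * c + 1) (hc : 4 ∣ c) (hc0 : c ≠ 0) (k : ℕ) (hk : k ≠ 0)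
    (h : ((⟨s, 1⟩ : GaussianInt) * ⟨c, s⟩ ^ (2 * k)).im = 1 ∨
      ((⟨s, 1⟩ : GaussianInt) * ⟨c, s⟩ ^ (2 * k)).im = -1) : False := by
  obtain ⟨r, l, hl, hkl⟩ := Nat.exists_eq_two_pow_mul_odd hk
  have hg : Good s c (2 ^ r) l ((-(⟨c, s⟩ : GaussianInt) ^ 2) ^ k) := by
    rw [hkl, pow_mul]
    exact ((base_good hs hc).pow_two_pow r).pow l
  obtain ⟨X, Y, e, hz, hXY⟩ := hg
  have hz2 : (-(⟨c, s⟩ : GaussianInt) ^ 2) ^ k = (-1) ^ k * ⟨c, s⟩ ^ (2 * k) := by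
    rw [neg_pow, pow_mul]
  rw [hz2] at hz
  have key : (⟨s, 1⟩ * (⟨1 + 2 * 2 ^ r * c * X, 2 * 2 ^ r * c * Y⟩ : GaussianInt)).im = 1 ∨
      (⟨s, 1⟩ * (⟨1 + 2 * 2 ^ r * c * X, 2 * 2 ^ r * c * Y⟩ : GaussianInt)).im = -1 := by
    rw [← hz]
    rcases neg_one_pow_eq_or GaussianInt k with h1 | h1 <;> rw [h1]
    · simpa using h
    · rw [neg_one_mul, mul_neg, Zsqrtd.im_neg]
      omega
  have e1 : (⟨s, 1⟩ * (⟨1 + 2 * 2 ^ r * c * X, 2 * 2 ^ r * c * Y⟩ : GaussianInt)).im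
      = 1 + c * (c * (2 ^ r * (l + 2 * e))) := by
    simp only [Zsqrtd.im_mul]
    linear_combination 2 ^ r * c * hXY
  rw [e1] at key
  rcases key with h1 | h1
  · have h2 : c * (c * (2 ^ r * (l + 2 * e))) = 0 := by linarith
    have h3 : (l : ℤ) + 2 * e = 0 := by simpa [hc0] using h2
    obtain ⟨j, rfl⟩ := hl
    omega
  · obtain ⟨d, rfl⟩ := hc
    have : 4 * (d * (4 * d * (2 ^ r * (l + 2 * e)))) = -2 := by linarith
    omega

lemma core_odd {s c : ℤ} (hs : s ^ 2 = 2 * c + 1) (hc : 4 ∣ c) (hc0 : c ≠ 0) (k : ℕ)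
    (h : ((⟨s, 1⟩ : GaussianInt) * ⟨c, s⟩ ^ (2 * k + 1)).im = 1 ∨
      ((⟨s, 1⟩ : GaussianInt) * ⟨c, s⟩ ^ (2 * k + 1)).im = -1) : False := by
  obtain ⟨X, Y, e, hz, hXY⟩ := (base_good hs hc).pow k
  have hz2 : (-(⟨c, s⟩ : GaussianInt) ^ 2) ^ k = (-1) ^ k * ⟨c, s⟩ ^ (2 * k) := by
    rw [neg_pow, pow_mul]
  rw [hz2] at hz
  have key : (⟨s, 1⟩ * ((⟨1 + 2 * 1 * c * X, 2 * 1 * c * Y⟩ : GaussianInt) * ⟨c, s⟩)).im = 1 ∨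
      (⟨s, 1⟩ * ((⟨1 + 2 * 1 * c * X, 2 * 1 * c * Y⟩ : GaussianInt) * ⟨c, s⟩)).im = -1 := by
    rw [← hz]
    rw [pow_succ] at h
    rcases neg_one_pow_eq_or GaussianInt k with h1 | h1 <;> rw [h1]
    · simpa only [one_mul] using h
    · rw [neg_one_mul, neg_mul, mul_neg, Zsqrtd.im_neg]
      omega
  have e1 : (⟨s, 1⟩ * ((⟨1 + 2 * 1 * c * X, 2 * 1 * c * Y⟩ : GaussianInt) * ⟨c, s⟩)).im
      = 1 + c * (1 + 2 * (1 + (3 * c + 1) * X + s * (c - 1) * Y)) := by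
    simp only [Zsqrtd.im_mul, Zsqrtd.re_mul]
    linear_combination (1 + 2 * c * X) * hs
  rw [e1] at key
  generalize (1 + (3 * c + 1) * X + s * (c - 1) * Y) = T at key
  rcases key with h1 | h1
  · have h2 : c * (1 + 2 * T) = 0 := by linarith
    rcases mul_eq_zero.mp h2 with h3 | h3
    · exact hc0 h3
    · omega
  · obtain ⟨d, rfl⟩ := hc
    have : 4 * (d * (1 + 2 * T)) = -2 := by linarith
    omega

lemma core {s c : ℤ} (hs : s ^ 2 = 2 * c + 1) (hc : 4 ∣ c) (hc0 : c ≠ 0) (m : ℕ) (hm : m ≠ 0)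
    (h : ((⟨s, 1⟩ : GaussianInt) * ⟨c, s⟩ ^ m).im = 1 ∨
      ((⟨s, 1⟩ : GaussianInt) * ⟨c, s⟩ ^ m).im = -1) : False := by
  rcases Nat.even_or_odd' m with ⟨k, rfl | rfl⟩
  · exact core_even hs hc hc0 k (by omega) h
  · exact core_odd hs hc hc0 k h

lemma dvd_im (s t C : ℤ) (m : ℕ) : t ∣ ((⟨s, t⟩ : GaussianInt) * ⟨C, s * t⟩ ^ m).im := by
  induction m with
  | zero => simp
  | succ m ih =>
    rw [pow_succ, ← mul_assoc, Zsqrtd.im_mul]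
    exact dvd_add (Dvd.dvd.mul_left (dvd_mul_left t s) _) (Dvd.dvd.mul_right ih _)

/-- The homogeneous version: `t ∣ 1` and then the core lemma applies. -/
lemma core_hom {s t C : ℤ} (hC : s ^ 2 - t ^ 2 = 2 * C) (hs : Odd s) (hC0 : t ^ 2 = 1 → C ≠ 0)
    (m : ℕ) (hm : m ≠ 0)
    (h : ((⟨s, t⟩ : GaussianInt) * ⟨C, s * t⟩ ^ m).im = 1 ∨
      ((⟨s, t⟩ : GaussianInt) * ⟨C, s * t⟩ ^ m).im = -1) : False := by
  have hd := dvd_im s t C m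
  have ht : t = 1 ∨ t = -1 := by
    apply Int.isUnit_iff.mp
    rcases h with h | h <;> rw [h] at hd
    · exact isUnit_of_dvd_one hd
    · exact isUnit_of_dvd_one (by simpa using hd)
  have ht2 : t ^ 2 = 1 := by rcases ht with rfl | rfl <;> rfl
  have hs2 : s ^ 2 = 2 * C + 1 := by linarith
  have h4 : 4 ∣ C := by
    have := Int.sq_mod_four_eq_one_of_odd hs
    obtain ⟨j, hj⟩ := hs
    obtain ⟨i, hi⟩ := Int.even_mul_succ_self j
    refine ⟨i, ?_⟩
    subst hj
    have : 2 * C = 2 * (4 * i) := by linear_combination -hs2 + 4 * hi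
    omega
  have hC1 := hC0 ht2
  rcases ht with rfl | rfl
  · rw [mul_one] at h
    exact core hs2 h4 hC1 m hm h
  · have e : ((⟨s, -1⟩ : GaussianInt) * ⟨C, s * -1⟩ ^ m) =
        star ((⟨s, 1⟩ : GaussianInt) * ⟨C, s⟩ ^ m) := by
      rw [star_mul, star_pow, mul_comm]
      congr 1
      · congr 1
        ext <;> simp
    rw [e, Zsqrtd.im_star] at h
    exact core hs2 h4 hC1 m hm (by omega)

lemma gauss_unit_pow (ε : GaussianIntˣ) : ε ^ 4 = 1 := by
  have h : (ε : GaussianInt).norm = 1 := (Zsqrtd.norm_eq_one_iff' (by norm_num) _).mpr ε.isUnit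
  apply Units.ext
  push_cast
  generalize (ε : GaussianInt) = x at *
  obtain ⟨a, b⟩ := x
  simp only [Zsqrtd.norm_def] at h
  have h' : a * a + b * b = 1 := by linarith
  have hab : a * b = 0 := by
    have ha : -1 ≤ a := by nlinarith
    have ha' : a ≤ 1 := by nlinarith
    have hb : -1 ≤ b := by nlinarith
    have hb' : b ≤ 1 := by nlinarith
    interval_cases a <;> interval_cases b <;> simp_all
  have e : (⟨a, b⟩ : GaussianInt) ^ 4 = (⟨a, b⟩ * ⟨a, b⟩) * (⟨a, b⟩ * ⟨a, b⟩) := by ring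
  rw [e]
  ext
  · simp only [Zsqrtd.re_mul, Zsqrtd.im_mul, Zsqrtd.re_one]
    linear_combination (a * a + b * b + 1) * h' - 8 * a * b * hab
  · simp only [Zsqrtd.re_mul, Zsqrtd.im_mul, Zsqrtd.im_one]
    linear_combination (4 * (a * a - b * b)) * hab

/-- If `q` is odd, then `a + (a+1) i` is a `q`-th power of a Gaussian integer. -/
lemma exists_root (q : ℕ) (hq : Odd q) (y a : ℤ) (h : y ^ q = a ^ 2 + (a + 1) ^ 2) :
    ∃ w : GaussianInt, w ^ q = ⟨a, a + 1⟩ := by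
  have hcop : IsCoprime (⟨a, a + 1⟩ : GaussianInt) ⟨a, -(a + 1)⟩ := by
    refine ⟨⟨a, -(a + 1)⟩ - ⟨a * (a + 1), 0⟩ * ⟨-1, -1⟩, -⟨a * (a + 1), 0⟩ * ⟨-1, 1⟩, ?_⟩
    ext <;> simp [Zsqrtd.re_mul, Zsqrtd.im_mul] <;> ring
  have hprod : (⟨a, a + 1⟩ : GaussianInt) * ⟨a, -(a + 1)⟩ = (y : GaussianInt) ^ q := by
    have h1 : (y : GaussianInt) ^ q = ((y ^ q : ℤ) : GaussianInt) := by push_cast; rfl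
    rw [h1, h]
    ext
    · rw [Zsqrtd.re_intCast, Zsqrtd.re_mul]; ring
    · rw [Zsqrtd.im_intCast, Zsqrtd.im_mul]; ring
  obtain ⟨d, ε, hd⟩ := exists_associated_pow_of_mul_eq_pow' hcop hprod
  refine ⟨d * (ε ^ q : GaussianIntˣ), ?_⟩
  rw [mul_pow, ← hd]
  congr 1
  have : (ε ^ q) ^ q = ε := by
    obtain ⟨j, rfl⟩ := hq
    rw [← pow_mul, show (2 * j + 1) * (2 * j + 1) = 4 * (j * j + j) + 1 by ring, pow_succ, pow_mul,
      gauss_unit_pow, one_pow, one_mul]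
  rw [← Units.val_pow_eq_pow_val, this]

/-- If `q ≥ 3` is odd, then `y^q = a² + (a+1)²` has no positive integer solutions. -/
theorem no_odd_power_sum_two_consecutive_squares
    (q : ℕ) (hq3 : 3 ≤ q) (hqodd : Odd q)
    (y a : ℕ) (hy : 0 < y) (ha : 0 < a) :
    y ^ q ≠ a ^ 2 + (a + 1) ^ 2 := by
  intro h
  obtain ⟨w, hw⟩ := exists_root q hqodd y a (by exact_mod_cast h)
  have hnorm : w.norm ^ q = (a : ℤ) ^ 2 + (a + 1) ^ 2 := by
    have := congrArg Zsqrtd.norm hw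
    have h2 : (w ^ q).norm = w.norm ^ q := map_pow Zsqrtd.normMonoidHom w q
    rw [← h2, this, Zsqrtd.norm_def]
    ring
  obtain ⟨m, rfl⟩ := hqodd
  obtain ⟨u, v⟩ := w
  have hN : (⟨u, v⟩ : GaussianInt).norm = u ^ 2 + v ^ 2 := by
    rw [Zsqrtd.norm_def]; ring
  rw [hN] at hnorm
  have hodd : Odd (u ^ 2 + v ^ 2) := by
    have : Odd ((u ^ 2 + v ^ 2) ^ (2 * m + 1)) := by
      rw [hnorm]
      exact ⟨a ^ 2 + a, by ring⟩
    exact (Int.odd_pow.mp this).resolve_right (by omega)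
  have hs : Odd (u - v) := by
    rcases Int.even_or_odd u with hu | hu <;> rcases Int.even_or_odd v with hv | hv <;>
      simp_all [Int.odd_add, Int.odd_sub, Int.even_pow, Int.odd_pow, parity_simps]
  have ht : Odd (u + v) := by
    have : u + v = (u - v) + 2 * v := by ring
    rw [this]
    exact hs.add_even (even_two_mul v)
  have hne : u ^ 2 + v ^ 2 ≠ 1 := by
    intro h1
    rw [h1, one_pow] at hnorm
    have : (0 : ℤ) < a := by exact_mod_cast ha
    nlinarith
  -- the main identity
  have hg : (⟨-2 * u * v, (u - v) * (u + v)⟩ : GaussianInt) = ⟨0, 1⟩ * ⟨u, v⟩ ^ 2 := by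
    rw [pow_two]
    ext <;> simp [Zsqrtd.re_mul, Zsqrtd.im_mul] <;> ring
  have hmain : (⟨u - v, u + v⟩ : GaussianInt) * ⟨-2 * u * v, (u - v) * (u + v)⟩ ^ m =
      ⟨0, 1⟩ ^ m * ⟨-1, 2 * a + 1⟩ := by
    have e1 : (⟨u - v, u + v⟩ : GaussianInt) = ⟨1, 1⟩ * ⟨u, v⟩ := by
      ext <;> simp [Zsqrtd.re_mul, Zsqrtd.im_mul] <;> ring
    have e2 : (⟨-1, 2 * a + 1⟩ : GaussianInt) = ⟨1, 1⟩ * ⟨a, a + 1⟩ := by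
      ext <;> simp [Zsqrtd.re_mul, Zsqrtd.im_mul] <;> ring
    rw [hg, e1, e2, ← hw]
    ring
  have hI : (⟨0, 1⟩ : GaussianInt) ^ 2 = -1 := by
    rw [pow_two]; ext <;> simp [Zsqrtd.re_mul, Zsqrtd.im_mul]
  rcases Nat.even_or_odd' m with ⟨k, hk | hk⟩
  · -- even case: use the real part
    have hre : ((⟨u - v, u + v⟩ : GaussianInt) * ⟨-2 * u * v, (u - v) * (u + v)⟩ ^ m).re = 1 ∨
        ((⟨u - v, u + v⟩ : GaussianInt) * ⟨-2 * u * v, (u - v) * (u + v)⟩ ^ m).re = -1 := by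
      rw [hmain, hk, pow_mul, hI]
      rcases neg_one_pow_eq_or GaussianInt k with h1 | h1 <;> rw [h1] <;> simp
    have e3 : (⟨u + v, u - v⟩ : GaussianInt) * ⟨2 * u * v, (u + v) * (u - v)⟩ ^ m =
        ⟨0, 1⟩ * star ((⟨u - v, u + v⟩ : GaussianInt) * ⟨-2 * u * v, (u - v) * (u + v)⟩ ^ m) := by
      have e4 : (⟨2 * u * v, (u + v) * (u - v)⟩ : GaussianInt) =
          - star ⟨-2 * u * v, (u - v) * (u + v)⟩ := by
        ext <;> simp <;> ring
      have e5 : (⟨u + v, u - v⟩ : GaussianInt) = ⟨0, 1⟩ * star ⟨u - v, u + v⟩ := by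
        ext <;> simp [Zsqrtd.re_mul, Zsqrtd.im_mul]
      rw [e4, e5, Even.neg_pow ⟨k, by omega⟩, star_mul, star_pow]
      ring
    refine core_hom (s := u + v) (t := u - v) (C := 2 * u * v) (by ring) ht ?_ m (by omega) ?_
    · intro h1 h2
      exact hne (by linarith)
    · rw [e3, Zsqrtd.im_mul, Zsqrtd.re_star, zero_mul, zero_add, one_mul]
      exact hre
  · refine core_hom (s := u - v) (t := u + v) (C := -2 * u * v) (by ring) hs ?_ m (by omega) ?_
    · intro h1 h2
      exact hne (by linarith)
    · rw [hmain, hk, pow_succ, pow_mul, hI]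
      rcases neg_one_pow_eq_or GaussianInt k with h1 | h1 <;> rw [h1] <;> simp [Zsqrtd.im_mul]
end

section
/- The Diophantine equation 2z^k = y² + 1 with integer k > 2 has only the positive integer solutions y = z = 1 and y = 239, z = 13, k = 4. -/
section
open Finset


namespace Ljung

noncomputable def ee (a : ℝ) (r : ℕ) : ℝ := ∏ k ∈ range r, (((k : ℝ) - a) / ((k : ℝ) + 1))

lemma ee_succ (a : ℝ) (r : ℕ) : ((r : ℝ) + 1) * ee a (r + 1) = ((r : ℝ) - a) * ee a r := by
  have : ((r : ℝ) + 1) ≠ 0 := by positivity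
  rw [ee, prod_range_succ, ← ee]; field_simp

noncomputable def hh (v : ℝ) (n r : ℕ) : ℝ :=
  if r ≤ n then ee (n - v) r * ((2 * n - r).choose n : ℝ) else 0

lemma hh_rec (v : ℝ) (n r : ℕ) :
    ((r : ℝ) + 1) * ((r : ℝ) - 2 * n) * hh v n (r + 1)
      = ((r : ℝ) - n + v) * ((r : ℝ) - n) * hh v n r := by
  rcases lt_trichotomy r n with h | h | h
  · rw [hh, hh, if_pos (by omega), if_pos (by omega)]
    have h1 := ee_succ (n - v) r
    obtain ⟨d, rfl⟩ : ∃ d, n = r + 1 + d := ⟨n - r - 1, by omega⟩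
    have e1 : 2 * (r + 1 + d) - (r + 1) = (r + 1 + d) + d := by omega
    have e2 : 2 * (r + 1 + d) - r = (r + 1 + d) + d + 1 := by omega
    rw [e1, e2]
    have h2 := Nat.add_one_mul_choose_eq ((r + 1 + d) + d) d
    have h3 : ((r + 1 + d) + d).choose (r + 1 + d) = ((r + 1 + d) + d).choose d := by
      rw [Nat.choose_symm_add]
    have h4 : ((r + 1 + d) + d + 1).choose (r + 1 + d) = ((r + 1 + d) + d + 1).choose (d + 1) := by
      rw [show (r + 1 + d) + d + 1 = (r + 1 + d) + (d + 1) by ring, Nat.choose_symm_add]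
    rw [h3, h4]
    have h5 : (((r + 1 + d) + d + 1 : ℕ) : ℝ) * ((((r + 1 + d) + d).choose d : ℕ) : ℝ)
      = ((((r + 1 + d) + d + 1).choose (d + 1) : ℕ) : ℝ) * ((d + 1 : ℕ) : ℝ) := by
      exact_mod_cast h2
    push_cast at h5 h1 ⊢
    set A := ((((r + 1 + d) + d).choose d : ℕ) : ℝ)
    set B := ((((r + 1 + d) + d + 1).choose (d + 1) : ℕ) : ℝ)
    set E := ee ((r : ℝ) + 1 + d - v) r
    set E' := ee ((r : ℝ) + 1 + d - v) (r + 1)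
    linear_combination (r - 2 * (r + 1 + d)) * A * h1 - ((r : ℝ) - (r + 1 + d - v)) * E * h5
  · subst h; rw [hh, if_neg (by omega)]; ring
  · rw [hh, hh, if_neg (by omega), if_neg (by omega)]; ring

noncomputable def fS (v : ℝ) : PowerSeries ℝ := PowerSeries.mk (ee v)
noncomputable def HP (v : ℝ) (n : ℕ) : Polynomial ℝ :=
  ∑ r ∈ range (n + 1), Polynomial.monomial r (hh v n r)

lemma HP_coeff (v : ℝ) (n r : ℕ) : (HP v n).coeff r = hh v n r := by
  rw [HP, Polynomial.finsetSum_coeff]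
  simp only [Polynomial.coeff_monomial]
  rw [sum_ite_eq']
  split_ifs with h
  · rfl
  · rw [hh, if_neg]; simpa using h

lemma HP_deg (v : ℝ) (n : ℕ) : (HP v n).natDegree ≤ n := by
  rw [Polynomial.natDegree_le_iff_coeff_eq_zero]
  intro N hN
  rw [HP_coeff, hh, if_neg (by omega)]

noncomputable def DS (v : ℝ) (n : ℕ) : PowerSeries ℝ := fS v * (HP v n : PowerSeries ℝ)

open PowerSeries in
lemma fS_ode (v : ℝ) : (1 - X) * d⁄dX ℝ (fS v) = - C v * fS v := by
  ext m
  rw [sub_mul, one_mul, map_sub, coeff_derivative, ← map_neg, coeff_C_mul]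
  rcases m with _ | m
  · simp [fS, ee]
  · rw [coeff_succ_X_mul, coeff_derivative]
    simp only [fS, coeff_mk]
    have := ee_succ v (m + 1)
    push_cast at this ⊢
    linear_combination this

open PowerSeries in
lemma coeff_ode (F : PowerSeries ℝ) (a b c : ℝ) (m : ℕ) :
    coeff m (X * (1 - X) * d⁄dX ℝ (d⁄dX ℝ F) - (C a + C b * X) * d⁄dX ℝ F - C c * F)
      = (m + 1) * (m - a) * coeff (m + 1) F - (m * (m - 1) + b * m + c) * coeff m F := by
  have e : X * (1 - X) * d⁄dX ℝ (d⁄dX ℝ F) - (C a + C b * X) * d⁄dX ℝ F - C c * F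
     = X * d⁄dX ℝ (d⁄dX ℝ F) - X * (X * d⁄dX ℝ (d⁄dX ℝ F)) - C a * d⁄dX ℝ F
       - C b * (X * d⁄dX ℝ F) - C c * F := by ring
  rw [e]
  simp only [map_sub, coeff_C_mul]
  rcases m with _ | m
  · simp [coeff_derivative]
  · rcases m with _ | m
    · simp only [coeff_succ_X_mul, coeff_derivative, coeff_zero_X_mul]
      push_cast; ring
    · simp only [coeff_succ_X_mul, coeff_derivative]
      push_cast; ring

open PowerSeries in
lemma HP_ode (v : ℝ) (n : ℕ) :
    X * (1 - X) * d⁄dX ℝ (d⁄dX ℝ (HP v n : PowerSeries ℝ))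
      - (C (2 * n : ℝ) + C (1 - 2 * n + v) * X) * d⁄dX ℝ (HP v n : PowerSeries ℝ)
      - C (n * (n - v)) * (HP v n : PowerSeries ℝ) = 0 := by
  ext m
  rw [coeff_ode, Polynomial.coeff_coe, Polynomial.coeff_coe, HP_coeff, HP_coeff]
  have := hh_rec v n m
  simp only [map_zero]
  linear_combination this

open PowerSeries in
lemma DS_ode (v : ℝ) (n : ℕ) :
    X * (1 - X) * d⁄dX ℝ (d⁄dX ℝ (DS v n))
      - (C (2 * n : ℝ) + C (1 - 2 * n - v) * X) * d⁄dX ℝ (DS v n)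
      - C (n * (n + v)) * DS v n = 0 := by
  have h1 := fS_ode v
  have h2 := HP_ode v n
  have h3 : (1 - X) * d⁄dX ℝ (d⁄dX ℝ (fS v)) = (1 - C v) * d⁄dX ℝ (fS v) := by
    have := congrArg (d⁄dX ℝ) h1
    simp only [Derivation.leibniz, smul_eq_mul, map_sub, derivative_X, derivative_one, derivative_C,
      map_neg] at this
    linear_combination this
  rw [DS]
  simp only [Derivation.leibniz, smul_eq_mul, map_add]
  set f := fS v
  set H := (HP v n : PowerSeries ℝ)
  set f1 := d⁄dX ℝ f
  set H1 := d⁄dX ℝ H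
  set f2 := d⁄dX ℝ f1
  set H2 := d⁄dX ℝ H1
  simp only [map_mul, map_sub, map_add, map_one, map_natCast, map_ofNat] at h2 ⊢
  linear_combination X * H * h3 + f * h2 + (2 * X * H1 - 2 * n * H) * h1

lemma DS_rec (v : ℝ) (n m : ℕ) :
    ((m : ℝ) + 1) * (m - 2 * n) * PowerSeries.coeff (m + 1) (DS v n)
      = (m - n - v) * (m - n) * PowerSeries.coeff m (DS v n) := by
  have := congrArg (PowerSeries.coeff m) (DS_ode v n)
  rw [coeff_ode, map_zero] at this
  linear_combination this

lemma DS_low (v : ℝ) (n m : ℕ) (hm : m ≤ 2 * n) :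
    PowerSeries.coeff m (DS v n) = hh (-v) n m := by
  induction m with
  | zero =>
    simp only [DS, PowerSeries.coeff_mul, Finset.Nat.antidiagonal_zero, sum_singleton,
      Polynomial.coeff_coe, HP_coeff]
    simp [fS, hh, ee]
  | succ m ih =>
    have h1 := DS_rec v n m
    have h2 := hh_rec (-v) n m
    rw [ih (by omega)] at h1
    have h3 : ((m : ℝ) + 1) * (m - 2 * n) ≠ 0 := by
      have : (m : ℝ) + 1 ≤ 2 * n := by exact_mod_cast hm
      have : (m : ℝ) - 2 * n < 0 := by linarith
      apply mul_ne_zero (by positivity) this.ne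
    apply mul_left_cancel₀ h3
    linear_combination h1 - h2

noncomputable def TT (v : ℝ) (n : ℕ) : ℝ := ∏ j ∈ range n, ((v - (j + 1)) / ((j : ℝ) + 1))

lemma hh_top (v : ℝ) (n : ℕ) : hh v n n = TT v n := by
  rw [hh, if_pos le_rfl, show 2 * n - n = n by omega, Nat.choose_self, Nat.cast_one, mul_one, ee, TT,
    prod_div_distrib, prod_div_distrib]
  congr 1
  rw [← prod_range_reflect]
  apply prod_congr rfl
  intro j hj
  have : j + 1 ≤ n := by simpa using hj
  rw [Nat.sub_sub, add_comm 1 j, Nat.cast_sub this]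
  push_cast; ring

lemma TT_pos (n : ℕ) : 0 < TT (1/4) n * TT (-(1/4)) n ∧ TT (1/4) n * TT (-(1/4)) n ≤ 1 := by
  rw [TT, TT, ← prod_mul_distrib]
  constructor
  · apply prod_pos
    intro j _
    have : (0 : ℝ) ≤ j := by positivity
    apply mul_pos_of_neg_of_neg
    · apply div_neg_of_neg_of_pos <;> linarith
    · apply div_neg_of_neg_of_pos <;> linarith
  · apply prod_le_one
    · intro j _
      have : (0 : ℝ) ≤ j := by positivity
      apply mul_nonneg_of_nonpos_of_nonpos
      · apply div_nonpos_of_nonpos_of_nonneg <;> linarith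
      · apply div_nonpos_of_nonpos_of_nonneg <;> linarith
    · intro j _
      have : (0 : ℝ) ≤ j := by positivity
      rw [div_mul_div_comm, div_le_one (by positivity)]
      nlinarith

noncomputable def kap (n : ℕ) : ℝ := TT (1/4) n * TT (-(1/4)) n * (1/2) / (n + 1)

lemma kap_pos (n : ℕ) : 0 < kap n := by
  have := (TT_pos n).1
  rw [kap]; positivity

lemma tail_dvd (n : ℕ) : (PowerSeries.X : PowerSeries ℝ) ^ (2 * n + 1) ∣
    ((HP (-(1/4)) n : PowerSeries ℝ) - DS (1/4) n) := by
  rw [PowerSeries.X_pow_dvd_iff]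
  intro m hm
  rw [map_sub, DS_low _ _ _ (by omega), Polynomial.coeff_coe, HP_coeff, sub_self]

lemma det_series (n : ℕ) :
    ((HP (-(1/4)) n * HP (1/4) (n+1) - HP (-(1/4)) (n+1) * HP (1/4) n : Polynomial ℝ) : PowerSeries ℝ)
     = ((HP (-(1/4)) n : PowerSeries ℝ) - DS (1/4) n) * (HP (1/4) (n+1) : PowerSeries ℝ)
      - ((HP (-(1/4)) (n+1) : PowerSeries ℝ) - DS (1/4) (n+1)) * (HP (1/4) n : PowerSeries ℝ) := by
  rw [Polynomial.coe_sub, Polynomial.coe_mul, Polynomial.coe_mul, DS, DS]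
  ring

lemma TT_succ (v : ℝ) (n : ℕ) : TT v (n+1) = TT v n * ((v - (n + 1)) / ((n : ℝ) + 1)) := by
  rw [TT, prod_range_succ, ← TT]

lemma det_poly (n : ℕ) :
    HP (-(1/4)) n * HP (1/4) (n+1) - HP (-(1/4)) (n+1) * HP (1/4) n
      = Polynomial.monomial (2 * n + 1) (kap n) := by
  ext m
  rw [Polynomial.coeff_monomial]
  rcases lt_trichotomy m (2 * n + 1) with h | h | h
  · rw [if_neg (by omega), ← Polynomial.coeff_coe, det_series]
    have : (PowerSeries.X : PowerSeries ℝ) ^ (2 * n + 1) ∣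
      ((HP (-(1/4)) n : PowerSeries ℝ) - DS (1/4) n) * (HP (1/4) (n+1) : PowerSeries ℝ)
      - ((HP (-(1/4)) (n+1) : PowerSeries ℝ) - DS (1/4) (n+1)) * (HP (1/4) n : PowerSeries ℝ) := by
      apply dvd_sub
      · exact (tail_dvd n).mul_right _
      · exact ((pow_dvd_pow _ (by omega)).trans (tail_dvd (n+1))).mul_right _
    exact PowerSeries.X_pow_dvd_iff.1 this m h
  · rw [if_pos h.symm, Polynomial.coeff_sub, h]
    rw [show 2 * n + 1 = n + (n + 1) by ring,
      Polynomial.coeff_mul_add_eq_of_natDegree_le (HP_deg _ _) (HP_deg _ _),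
      show n + (n + 1) = (n + 1) + n by ring,
      Polynomial.coeff_mul_add_eq_of_natDegree_le (HP_deg _ _) (HP_deg _ _)]
    simp only [HP_coeff, hh_top, TT_succ, kap]
    field_simp
    ring
  · rw [if_neg (by omega)]
    apply Polynomial.coeff_eq_zero_of_natDegree_lt
    refine lt_of_le_of_lt (Polynomial.natDegree_sub_le _ _) ?_
    rw [max_lt_iff]
    constructor
    · refine lt_of_le_of_lt Polynomial.natDegree_mul_le ?_
      have := HP_deg (-(1/4)) n
      have := HP_deg (1/4) (n+1)
      omega
    · refine lt_of_le_of_lt Polynomial.natDegree_mul_le ?_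
      have := HP_deg (-(1/4)) (n+1)
      have := HP_deg (1/4) n
      omega

lemma D_mid (n : ℕ) : - PowerSeries.coeff (2*n+1) (DS (1/4) n) * ((n+1).centralBinom : ℝ) = kap n := by
  have h := congrArg (fun p : Polynomial ℝ => PowerSeries.coeff (2*n+1) (p : PowerSeries ℝ)) (det_poly n)
  rw [det_series, Polynomial.coeff_coe, Polynomial.coeff_monomial, if_pos rfl, map_sub] at h
  obtain ⟨U, hU⟩ := tail_dvd n
  obtain ⟨V, hV⟩ := tail_dvd (n+1)
  have h1 : PowerSeries.coeff (2*n+1) (((HP (-(1/4)) (n+1) : PowerSeries ℝ) - DS (1/4) (n+1)) * (HP (1/4) n : PowerSeries ℝ)) = 0 := by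
    have : (PowerSeries.X : PowerSeries ℝ) ^ (2 * n + 2) ∣ ((HP (-(1/4)) (n+1) : PowerSeries ℝ) - DS (1/4) (n+1)) * (HP (1/4) n : PowerSeries ℝ) :=
      ((pow_dvd_pow _ (by omega)).trans (tail_dvd (n+1))).mul_right _
    exact PowerSeries.X_pow_dvd_iff.1 this _ (by omega)
  have h2 : PowerSeries.coeff (2*n+1) ((HP (-(1/4)) n : PowerSeries ℝ) - DS (1/4) n) = - PowerSeries.coeff (2*n+1) (DS (1/4) n) := by
    rw [map_sub, Polynomial.coeff_coe, HP_coeff, hh, if_neg (by omega)]; ring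
  rw [h1, sub_zero, hU, mul_assoc, PowerSeries.coeff_X_pow_mul', if_pos le_rfl] at h
  rw [hU, PowerSeries.coeff_X_pow_mul', if_pos le_rfl] at h2
  rw [Nat.sub_self] at h h2
  rw [← h, ← h2, PowerSeries.coeff_mul, Finset.Nat.antidiagonal_zero, sum_singleton, Polynomial.coeff_coe, HP_coeff]
  simp [hh, ee, Nat.centralBinom]

lemma D_mid_bd (n : ℕ) : |PowerSeries.coeff (2*n+1) (DS (1/4) n)| ≤ (1/4)^(n+1) := by
  have h := D_mid n
  have hb : (4:ℝ)^(n+1) ≤ 2 * (n+1) * ((n+1).centralBinom : ℝ) := by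
    exact_mod_cast Nat.four_pow_le_two_mul_self_mul_centralBinom (n+1) (by omega)
  have hc : (0:ℝ) < ((n+1).centralBinom : ℝ) := by exact_mod_cast Nat.centralBinom_pos _
  have hk : |PowerSeries.coeff (2*n+1) (DS (1/4) n)| * ((n+1).centralBinom : ℝ) = kap n := by
    have := congrArg abs h
    rwa [abs_mul, abs_neg, abs_of_pos hc, abs_of_pos (kap_pos n)] at this
  have hk2 : kap n * (n+1) ≤ 1/2 := by
    have := (TT_pos n).2
    rw [kap, div_mul_cancel₀ _ (by positivity)]; linarith
  set d := |PowerSeries.coeff (2*n+1) (DS (1/4) n)|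
  have hd : 0 ≤ d := abs_nonneg _
  rw [one_div, inv_pow, ← one_div, le_div_iff₀ (by positivity)]
  calc d * 4^(n+1) ≤ d * (2 * (n+1) * ((n+1).centralBinom : ℝ)) := by gcongr
    _ = 2 * (kap n * (n+1)) := by rw [← hk]; ring
    _ ≤ 1 := by linarith

lemma D_tail_bd (n j : ℕ) :
    |PowerSeries.coeff (2*n+1+j) (DS (1/4) n)| ≤ (1/4)^(n+1) * ((j+n).choose n : ℝ) := by
  induction j with
  | zero => simpa using D_mid_bd n
  | succ j ih =>
    have h := DS_rec (1/4) n (2*n+1+j)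
    have h' := congrArg abs h
    rw [abs_mul, abs_mul _ (PowerSeries.coeff (2*n+1+j) _)] at h'
    push_cast at h'
    have hn : (0:ℝ) ≤ n := by positivity
    have hj : (0:ℝ) ≤ j := by positivity
    rw [abs_of_nonneg (by nlinarith : (0:ℝ) ≤ (2*n+1+j+1)*(2*n+1+j-2*n)),
      abs_of_nonneg (by nlinarith : (0:ℝ) ≤ (2*n+1+j-n-1/4)*(2*n+1+j-n))] at h'
    have hc : ((j+n).choose n : ℝ) * (j + n + 1) = ((j+1+n).choose n : ℝ) * (j+1) := by
      have := Nat.add_one_mul_choose_eq (j+n) j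
      have e1 : (j+n).choose n = (j+n).choose j := (Nat.choose_symm_add).symm
      have e2 : (j+1+n).choose n = (j+n+1).choose (j+1) := by
        rw [show j+n+1 = (j+1)+n by ring]; exact (Nat.choose_symm_add).symm
      rw [e1, e2]
      have : (((j+n+1 : ℕ):ℝ)) * ((j+n).choose j : ℝ) = ((j+n+1).choose (j+1) : ℝ) * ((j+1 : ℕ):ℝ) := by
        exact_mod_cast this
      push_cast at this; linarith
    set a := |PowerSeries.coeff (2*n+1+j) (DS (1/4) n)|
    rw [show 2*n+1+(j+1) = 2*n+1+j+1 by ring]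
    set b := |PowerSeries.coeff (2*n+1+j+1) (DS (1/4) n)|
    have ha : 0 ≤ a := abs_nonneg _
    have hb : 0 ≤ b := abs_nonneg _
    have h1 : b * (j+1) ≤ a * (j+n+1) := by
      have : (2*n+2+j) * (b * (j+1)) ≤ (2*n+2+j) * (a * (j+n+1)) := by
        have : (2*n+1+j-n-1/4)*(2*n+1+j-n) * a ≤ (2*n+2+j) * (j+n+1) * a := by
          apply mul_le_mul_of_nonneg_right _ ha
          nlinarith
        nlinarith
      exact le_of_mul_le_mul_left this (by positivity)
    have h2 : b * (j+1) ≤ ((1/4)^(n+1) * ((j+1+n).choose n : ℝ)) * (j+1) := by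
      calc b * (j+1) ≤ a * (j+n+1) := h1
        _ ≤ ((1/4)^(n+1) * ((j+n).choose n : ℝ)) * (j+n+1) := by gcongr
        _ = _ := by rw [mul_assoc, hc]; ring
    exact le_of_mul_le_mul_right h2 (by positivity)

end Ljung

namespace Ljung

lemma desc_prod {R : Type*} [CommRing R] (a : R) (s : ℕ) :
    (descPochhammer ℤ s).smeval a = ∏ k ∈ range s, (a - (k : R)) := by
  induction s with
  | zero => simp
  | succ s ih =>
    rw [prod_range_succ, ← ih]
    simp [descPochhammer_succ_right, Polynomial.smeval_mul, Polynomial.smeval_natCast]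

lemma ee_choose (v : ℝ) (s : ℕ) : ((ee v s : ℝ) : ℂ) = (-1)^s * Ring.choose (v : ℂ) s := by
  rw [← Complex.ofReal_choose]
  have : ee v s = (-1)^s * Ring.choose v s := by
    have h := Ring.descPochhammer_eq_factorial_smul_choose v s
    rw [desc_prod, nsmul_eq_mul] at h
    have hf0 : (s.factorial : ℝ) ≠ 0 := by positivity
    have hfac : ∏ k ∈ range s, ((k:ℝ) + 1) = (s.factorial : ℝ) := by
      rw [← prod_range_add_one_eq_factorial]; push_cast; rfl
    have hp : ∏ k ∈ range s, ((k:ℝ) - v) = (-1)^s * ∏ k ∈ range s, (v - (k:ℝ)) := by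
      rw [← card_range s, ← prod_const, card_range, ← prod_mul_distrib]
      apply prod_congr rfl; intros; ring
    rw [ee, prod_div_distrib, hfac, div_eq_iff hf0, hp, h]; ring
  rw [this]; push_cast; rfl

lemma ee_abs (s : ℕ) : |ee (1/4) s| ≤ 1 := by
  rw [ee, abs_prod]
  apply prod_le_one
  · intros; positivity
  · intro k _
    have : (0:ℝ) ≤ k := by positivity
    rw [abs_div, abs_of_pos (by positivity : (0:ℝ) < k + 1), div_le_one (by positivity), abs_le]
    constructor <;> linarith

lemma w_exists (x : ℂ) (hx : ‖x‖ < 1) : ∃ w : ℂ, w ^ 4 = 1 - x ∧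
    HasSum (fun s => ((ee (1/4) s : ℝ) : ℂ) * x ^ s) w := by
  refine ⟨(1 + -x) ^ (((1/4 : ℝ) : ℂ)), ?_, ?_⟩
  · rw [← Complex.cpow_nat_mul]
    norm_num
    rw [sub_eq_add_neg]
  · have h := (Complex.one_add_cpow_hasFPowerSeriesOnBall_zero (a := ((1/4 : ℝ) : ℂ))).hasSum
      (y := -x) (by
        rw [← ENNReal.ofReal_one, Metric.eball_ofReal]; simpa using hx)
    rw [zero_add] at h
    have e : (fun s => ((ee (1/4) s : ℝ) : ℂ) * x ^ s)
        = fun n => (binomialSeries ℂ (((1/4 : ℝ) : ℂ)) n) fun _ => -x := by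
      ext s
      rw [ee_choose, binomialSeries_apply]
      simp [neg_pow x]
      ring
    rw [e]
    exact h

noncomputable def HC (v : ℝ) (n : ℕ) (x : ℂ) : ℂ := ∑ r ∈ range (n + 1), ((hh v n r : ℝ) : ℂ) * x ^ r

lemma HC_eq (v : ℝ) (n : ℕ) (x : ℂ) : HC v n x = Polynomial.aeval x (HP v n) := by
  rw [HP, map_sum, HC]
  simp [Polynomial.aeval_monomial]

lemma HC_det (n : ℕ) (x : ℂ) : HC (-(1/4)) n x * HC (1/4) (n+1) x - HC (-(1/4)) (n+1) x * HC (1/4) n x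
    = ((kap n : ℝ) : ℂ) * x ^ (2 * n + 1) := by
  simp only [HC_eq, ← map_mul, ← map_sub]
  rw [det_poly]
  simp [Polynomial.aeval_monomial]

lemma HC_hasSum (v : ℝ) (n : ℕ) (x : ℂ) : HasSum (fun r => ((hh v n r : ℝ) : ℂ) * x ^ r) (HC v n x) := by
  apply hasSum_sum_of_ne_finset_zero
  intro r hr
  rw [hh, if_neg (by simpa using hr)]; simp

lemma tail_bound (n : ℕ) (x : ℂ) (hx : ‖x‖ < 1) (S : ℂ) (a : ℕ → ℝ)
    (ha : ∀ j, |a j| ≤ (1/4)^(n+1) * ((j+n).choose n : ℝ))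
    (hS : HasSum (fun j => ((a j : ℝ) : ℂ) * x ^ (j + (2*n+1))) S) :
    ‖S‖ ≤ (1/4)^(n+1) * ‖x‖^(2*n+1) / (1 - ‖x‖)^(n+1) := by
  have h0 : HasSum (fun j : ℕ => ((j+n).choose n : ℝ) * ‖x‖^j) (1/(1-‖x‖)^(n+1)) := by
    have hx' : ‖(‖x‖)‖ < 1 := by rw [norm_norm]; exact hx
    exact hasSum_choose_mul_geometric_of_norm_lt_one (𝕜 := ℝ) (r := ‖x‖) n hx'
  have hb : HasSum (fun j : ℕ => (1/4:ℝ)^(n+1) * ‖x‖^(2*n+1) * (((j+n).choose n : ℝ) * ‖x‖^j))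
      ((1/4:ℝ)^(n+1) * ‖x‖^(2*n+1) * (1/(1-‖x‖)^(n+1))) :=
    HasSum.mul_left _ h0
  rw [← mul_one_div]
  refine hS.norm_le_of_bounded hb (fun j => ?_)
  rw [norm_mul, norm_pow, Complex.norm_real, Real.norm_eq_abs, pow_add]
  calc |a j| * (‖x‖^j * ‖x‖^(2*n+1)) ≤ ((1/4)^(n+1) * ((j+n).choose n : ℝ)) * (‖x‖^j * ‖x‖^(2*n+1)) :=
        mul_le_mul_of_nonneg_right (ha j) (by positivity)
    _ = _ := by ring

lemma key (x : ℂ) (hx : ‖x‖ < 1) : ∃ w : ℂ, w ^ 4 = 1 - x ∧ ‖w - 1‖ ≤ ‖x‖ / (1 - ‖x‖) ∧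
    ∀ n, ‖HC (-(1/4)) n x - w * HC (1/4) n x‖ ≤ (1/4)^(n+1) * ‖x‖^(2*n+1) / (1 - ‖x‖)^(n+1) := by
  obtain ⟨w, hw, hs⟩ := w_exists x hx
  have hx0 := norm_nonneg x
  refine ⟨w, hw, ?_, ?_⟩
  · have h1 := (hasSum_nat_add_iff' 1).2 hs
    simp only [range_one, sum_singleton, pow_zero, mul_one] at h1
    have e0 : ((ee (1/4) 0 : ℝ) : ℂ) = 1 := by simp [ee]
    rw [e0] at h1
    have h2 : HasSum (fun s : ℕ => ‖x‖ * ‖x‖ ^ s) (‖x‖ * (1 - ‖x‖)⁻¹) :=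
      (hasSum_geometric_of_lt_one hx0 hx).mul_left _
    have := h1.norm_le_of_bounded h2 (fun s => by
      rw [norm_mul, norm_pow, Complex.norm_real, pow_succ', Real.norm_eq_abs]
      have := ee_abs (s+1)
      calc _ ≤ 1 * (‖x‖ * ‖x‖^s) := by gcongr
        _ = _ := by ring)
    simpa [div_eq_mul_inv] using this
  · intro n
    have sn1 : Summable (fun s => ‖((ee (1/4) s : ℝ) : ℂ) * x ^ s‖) := by
      refine Summable.of_nonneg_of_le (fun _ => norm_nonneg _) (fun s => ?_) (summable_geometric_of_lt_one hx0 hx)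
      rw [norm_mul, norm_pow, Complex.norm_real, Real.norm_eq_abs]
      have := ee_abs s
      calc _ ≤ 1 * ‖x‖^s := by gcongr
        _ = _ := by ring
    have sn2 : Summable (fun r => ‖((hh (1/4) n r : ℝ) : ℂ) * x ^ r‖) := by
      apply summable_of_ne_finset_zero (s := range (n+1))
      intro r hr
      rw [hh, if_neg (by simpa using hr)]; simp
    have hD0 : HasSum (fun m => ((PowerSeries.coeff m (DS (1/4) n) : ℝ) : ℂ) * x ^ m) (w * HC (1/4) n x) := by
      have h3 := (summable_norm_sum_mul_antidiagonal_of_summable_norm sn1 sn2).of_norm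
      have h4 := tsum_mul_tsum_eq_tsum_sum_antidiagonal_of_summable_norm sn1 sn2
      rw [hs.tsum_eq, (HC_hasSum (1/4) n x).tsum_eq] at h4
      rw [h4]
      have e : (fun m => ((PowerSeries.coeff m (DS (1/4) n) : ℝ) : ℂ) * x ^ m)
        = fun m => ∑ kl ∈ Finset.HasAntidiagonal.antidiagonal m, (((ee (1/4) kl.1 : ℝ) : ℂ) * x ^ kl.1) *
            (((hh (1/4) n kl.2 : ℝ) : ℂ) * x ^ kl.2) := by
       ext m
       rw [DS, PowerSeries.coeff_mul]
       push_cast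
       rw [sum_mul]
       apply sum_congr rfl
       intro p hp
       rw [HP_coeff, fS, PowerSeries.coeff_mk]
       rw [← mem_antidiagonal.1 hp, pow_add]; ring
      rw [e]
      exact h3.hasSum
    have hR := hD0.sub (HC_hasSum (-(1/4)) n x)
    have hR' := (hasSum_nat_add_iff' (2*n+1)).2 hR
    rw [sum_eq_zero (s := range (2*n+1)), sub_zero] at hR'
    · rw [← norm_neg, neg_sub]
      refine tail_bound n x hx _ (fun j => PowerSeries.coeff (2*n+1+j) (DS (1/4) n)) (D_tail_bd n) ?_
      have e : (fun j => ((PowerSeries.coeff (2*n+1+j) (DS (1/4) n) : ℝ) : ℂ) * x ^ (j + (2*n+1)))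
        = fun j => ((PowerSeries.coeff (j+(2*n+1)) (DS (1/4) n) : ℝ) : ℂ) * x ^ (j + (2*n+1))
          - ((hh (-(1/4)) n (j+(2*n+1)) : ℝ) : ℂ) * x ^ (j + (2*n+1)) := by
        ext j
        rw [hh, if_neg (by omega), Complex.ofReal_zero, zero_mul, sub_zero, add_comm j (2*n+1)]
      rw [e]
      exact hR'
    · intro m hm
      rw [DS_low _ _ _ (by simp at hm; omega), sub_self]

lemma hh_bd (n r : ℕ) : |hh (1/4) n r| ≤ 4^n * (n.choose r : ℝ) := by
  rw [hh]
  split_ifs with h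
  · rw [abs_mul, mul_comm]
    have h1 : |(((2*n-r).choose n : ℕ) : ℝ)| ≤ 4^n := by
      rw [abs_of_nonneg (by positivity)]
      have : (2*n-r).choose n ≤ 4^n := by
        calc _ ≤ (2*n).choose n := Nat.choose_le_choose _ (by omega)
          _ ≤ 2^(2*n) := Nat.choose_le_two_pow _ _
          _ = 4^n := by rw [pow_mul]; norm_num
      exact_mod_cast this
    have h2 : |ee (n - 1/4) r| ≤ (n.choose r : ℝ) := by
      induction r with
      | zero => simp [ee]
      | succ r ih =>
        have hr := ih (by omega) (by
          rw [abs_of_nonneg (by positivity)]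
          have : (2*n-r).choose n ≤ 4^n := by
            calc _ ≤ (2*n).choose n := Nat.choose_le_choose _ (by omega)
              _ ≤ 2^(2*n) := Nat.choose_le_two_pow _ _
              _ = 4^n := by rw [pow_mul]; norm_num
          exact_mod_cast this)
        have e := congrArg abs (ee_succ (n - 1/4) r)
        rw [abs_mul, abs_mul, abs_of_pos (by positivity : (0:ℝ) < r + 1)] at e
        have hrn : (r : ℝ) + 1 ≤ n := by exact_mod_cast h
        have e2 : |(r : ℝ) - (n - 1/4)| ≤ n - r := by rw [abs_le]; constructor <;> linarith
        have e3 : (n.choose (r+1) : ℝ) * (r+1) = (n.choose r : ℝ) * (n - r) := by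
          have := Nat.choose_succ_right_eq n r
          rw [← Nat.cast_sub (by omega)]
          exact_mod_cast this
        have : (r+1) * |ee (n - 1/4) (r+1)| ≤ (r+1) * (n.choose (r+1) : ℝ) := by
          rw [e, mul_comm ((r:ℝ)+1), e3, mul_comm]
          exact mul_le_mul hr e2 (abs_nonneg _) (by positivity)
        exact le_of_mul_le_mul_left this (by positivity)
    gcongr
  · simp

lemma HC_bd (n : ℕ) (x : ℂ) : ‖HC (1/4) n x‖ ≤ (4 * (1 + ‖x‖))^n := by
  rw [HC]
  refine (norm_sum_le _ _).trans ?_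
  rw [mul_pow, add_comm (1:ℝ), add_pow, mul_sum]
  apply sum_le_sum
  intro r _
  rw [norm_mul, norm_pow, Complex.norm_real, Real.norm_eq_abs]
  calc _ ≤ (4^n * (n.choose r : ℝ)) * ‖x‖^r := by gcongr; exact hh_bd n r
    _ = _ := by ring

lemma int_prod (u : ℤ) (r : ℕ) : (r.factorial : ℤ) ∣ 2^r * ∏ k ∈ range r, (u - 4 * k) := by
  obtain ⟨e, o, ho, hf⟩ := Nat.exists_eq_two_pow_mul_odd (Nat.factorial_ne_zero r)
  have he : e ≤ r := by
    have h1 := sub_one_mul_padicValNat_factorial (p := 2) r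
    have h2 : 2^e ∣ r.factorial := ⟨o, hf⟩
    have := (padicValNat_dvd_iff_le (p := 2) (Nat.factorial_ne_zero r)).1 h2
    omega
  have h1 : (o : ℤ) ∣ ∏ k ∈ range r, (u - 4 * k) := by
    have hc : IsCoprime (4 : ℤ) (o : ℤ) := by
      have : Nat.Coprime (2^2) o := (Nat.coprime_pow_left_iff (by norm_num) _ _).2 (Nat.coprime_two_left.2 ho)
      have := Nat.isCoprime_iff_coprime.2 this
      simpa using this
    obtain ⟨a, b, hab⟩ := hc
    have h2 : (∏ k ∈ range r, (u - 4 * k)) ≡ ∏ k ∈ range r, (4 * (u * a - k)) [ZMOD o] := by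
      apply Int.ModEq.prod
      intro k _
      rw [Int.modEq_iff_dvd]
      exact ⟨-(u * b), by linear_combination u * hab⟩
    have h3 : (o : ℤ) ∣ ∏ k ∈ range r, (4 * (u * a - k)) := by
      rw [prod_mul_distrib, ← desc_prod (u * a) r, Ring.descPochhammer_eq_factorial_smul_choose,
        nsmul_eq_mul]
      refine Dvd.dvd.mul_left (Dvd.dvd.mul_right ?_ _) _
      exact_mod_cast (⟨2^e, by rw [hf, mul_comm]⟩ : o ∣ r.factorial)
    exact (Int.ModEq.dvd_iff h2).2 h3
  rw [hf]; push_cast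
  exact mul_dvd_mul (pow_dvd_pow _ he) h1

lemma int_hh (s : ℤ) (n r : ℕ) : ∃ t : ℤ, 8^r * hh (s/4) n r = t := by
  rw [hh]
  split_ifs with h
  · obtain ⟨t, ht⟩ := int_prod (4*n - s) r
    refine ⟨(-1)^r * t * ((2*n-r).choose n), ?_⟩
    have ht' : (2:ℝ)^r * ∏ k ∈ range r, ((4*n - s : ℝ) - 4 * k) = (r.factorial : ℝ) * t := by
      exact_mod_cast ht
    have hee : 8^r * ee (n - s/4) r = (-1)^r * t := by
      rw [ee, prod_div_distrib]
      have hfac : ∏ k ∈ range r, ((k:ℝ) + 1) = (r.factorial : ℝ) := by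
        rw [← prod_range_add_one_eq_factorial]; push_cast; rfl
      rw [hfac]
      have hp : ∏ k ∈ range r, ((4*n - s : ℝ) - 4 * k) = (-4)^r * ∏ k ∈ range r, ((k:ℝ) - (n - s/4)) := by
        rw [← card_range r, ← prod_const, card_range, ← prod_mul_distrib]
        apply prod_congr rfl; intros; ring
      rw [hp] at ht'
      have hf0 : (r.factorial : ℝ) ≠ 0 := by positivity
      rw [mul_div_assoc', div_eq_iff hf0]
      have : (8:ℝ)^r = (-1)^r * (2^r * (-4)^r) := by rw [← mul_pow, ← mul_pow]; norm_num
      rw [this]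
      linear_combination (-1)^r * ht'
    push_cast
    rw [← hee]; ring
  · exact ⟨0, by simp⟩

end Ljung

namespace Ljung
open Complex ComplexConjugate

lemma integral_HC (s : ℤ) (n : ℕ) : ∃ P : GaussianInt,
    GaussianInt.toComplex P = 8^n * ((3 + 2 * I)^4)^n * HC (s/4) n ((1 + I) / (3 + 2 * I)^4) := by
  choose t ht using int_hh s n
  refine ⟨∑ r ∈ range (n+1), 8^(n-r) * (t r : GaussianInt) * (⟨1,1⟩ : GaussianInt)^r *
      ((⟨3,2⟩ : GaussianInt)^4)^(n-r), ?_⟩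
  rw [HC, map_sum, mul_sum]
  apply sum_congr rfl
  intro r hr
  have hr' : r ≤ n := by simpa [Nat.lt_succ_iff] using hr
  have h0 : (3 + 2 * I) ^ 4 ≠ 0 := by
    apply pow_ne_zero
    intro h
    have := congrArg Complex.re h
    simp at this
  have h1 : (8:ℂ)^r * ((hh (s/4) n r : ℝ) : ℂ) = (t r : ℂ) := by
    have := congrArg (fun z : ℝ => (z : ℂ)) (ht r)
    push_cast at this ⊢
    exact this
  simp only [map_mul, map_pow, map_ofNat, map_intCast, GaussianInt.toComplex_def']
  push_cast
  rw [← h1, div_pow, ← pow_sub_mul_pow _ hr', ← pow_sub_mul_pow ((3 + 2 * I)^4) hr', one_mul]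
  generalize (3 + 2 * I) ^ 4 = K at h0 ⊢
  have hK : K ^ r ≠ 0 := pow_ne_zero _ h0
  field_simp

lemma roots4 (a b : ℂ) (h : a^4 = b^4) : ∃ u : GaussianInt, a = GaussianInt.toComplex u * b ∧
    ‖GaussianInt.toComplex u‖ = 1 := by
  have : (a - b) * ((a + b) * ((a - I * b) * (a + I * b))) = 0 := by
    linear_combination h - (b^2*a^2 - b^4) * I_sq
  rcases mul_eq_zero.1 this with h | h
  · exact ⟨1, by simp; linear_combination h, by simp⟩
  rcases mul_eq_zero.1 h with h | h
  · exact ⟨-1, by simp; linear_combination h, by simp⟩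
  rcases mul_eq_zero.1 h with h | h
  · exact ⟨⟨0,1⟩, by simp [GaussianInt.toComplex_def']; linear_combination h, by simp [GaussianInt.toComplex_def']⟩
  · exact ⟨⟨0,-1⟩, by simp [GaussianInt.toComplex_def']; linear_combination h, by simp [GaussianInt.toComplex_def']⟩

lemma small_gauss (u : GaussianInt) (h : ‖GaussianInt.toComplex u‖ < 1) : u = 0 := by
  by_contra h0
  have h1 : 0 < u.norm := GaussianInt.norm_pos.2 h0
  have h2 : (u.norm : ℝ) = Complex.normSq (GaussianInt.toComplex u) := GaussianInt.intCast_real_norm u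
  rw [Complex.normSq_eq_norm_sq] at h2
  have h3 : (1:ℝ) ≤ u.norm := by exact_mod_cast h1
  have := norm_nonneg (GaussianInt.toComplex u)
  nlinarith

lemma norm_g0 : ‖(3 + 2 * I : ℂ)‖ ^ 2 = 13 := by
  rw [← Complex.normSq_eq_norm_sq]; simp [Complex.normSq_apply]; norm_num

lemma norm_1I : ‖(1 + I : ℂ)‖ ^ 2 = 2 := by
  rw [← Complex.normSq_eq_norm_sq]; simp [Complex.normSq_apply]; norm_num

lemma est (n : ℕ) (A t q p t' W : ℝ) (hA : 3 * 18^n ≤ A) (hA2 : A < 50 * 41^n)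
    (ht0 : 0 ≤ t) (ht : t^2 = 2/28561) (hq0 : 0 ≤ q) (hq : q ≤ 4 * A) (hp0 : 0 ≤ p) (hp : p ≤ 4 * A)
    (ht' : 0 ≤ t') (ht'' : t' * A^4 ≤ 3/2) (hW : W ≤ t' / (1 - t')) (hW0 : 0 ≤ W) :
    q * (8^n * 169^n * ((1/4)^(n+1) * t^(2*n+1) / (1 - t)^(n+1)))
      + 8^n * 169^n * (4 * (1 + t))^n * p * W < 1 := by
  have h18 : (1:ℝ) ≤ 18^n := one_le_pow₀ (by norm_num)
  have hA3 : 3 ≤ A := by linarith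
  have htb : t ≤ 1/119 := by
    by_contra h; push Not at h; nlinarith
  have ht'b : t' ≤ 1/2 := by
    by_contra h; push Not at h
    have : (3:ℝ)^4 ≤ A^4 := by gcongr
    nlinarith
  have hW2 : W ≤ 2 * t' := by
    refine hW.trans ?_
    rw [div_le_iff₀ (by linarith)]; nlinarith
  have h1 : q * (8^n * 169^n * ((1/4)^(n+1) * t^(2*n+1) / (1 - t)^(n+1))) < 1/2 := by
    have e : q * (8^n * 169^n * ((1/4)^(n+1) * t^(2*n+1) / (1 - t)^(n+1)))
        = q * (1/4) * (t / (1-t)) * (338 * t^2 / (1 - t))^n := by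
      have : (1 - t) ≠ 0 := by linarith
      have e338 : (338:ℝ)^n = 8^n * 169^n * (1/4)^n := by
        rw [← mul_pow, ← mul_pow]; norm_num
      rw [div_pow (338 * t^2), mul_pow (338:ℝ), pow_succ t, pow_succ (1-t), pow_succ (1/4:ℝ), pow_mul,
        e338]
      field_simp
    rw [e]
    have b1 : t / (1-t) ≤ 1/118 := by rw [div_le_iff₀ (by linarith)]; linarith
    have b2 : 338 * t^2 / (1 - t) ≤ 1/41 := by
      rw [div_le_iff₀ (by linarith), ht]; linarith
    have b0 : 0 ≤ t / (1-t) := div_nonneg ht0 (by linarith)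
    have b3 : 0 ≤ 338 * t^2 / (1 - t) := div_nonneg (by positivity) (by linarith)
    calc q * (1/4) * (t / (1-t)) * (338 * t^2 / (1 - t))^n ≤ (4 * A) * (1/4) * (1/118) * (1/41)^n := by gcongr
      _ = A / 41^n / 118 := by rw [div_pow, one_pow]; ring
      _ < 50 / 118 := by
        gcongr
        rw [div_lt_iff₀ (by positivity)]; exact hA2
      _ < 1/2 := by norm_num
  have h2 : 8^n * 169^n * (4 * (1 + t))^n * p * W < 1/2 := by
    have e : 8^n * 169^n * (4 * (1 + t))^n * p * W = (5408 * (1 + t))^n * (p * W) := by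
      rw [show 5408 * (1+t) = 8 * 169 * (4 * (1+t)) by ring, mul_pow (8*169:ℝ), mul_pow (8:ℝ) 169]; ring
    rw [e]
    have b1 : 5408 * (1+t) ≤ 18^3 := by linarith
    have b2 : p * W ≤ 12 / A^3 := by
      rw [le_div_iff₀ (by positivity)]
      calc p * W * A^3 ≤ (4 * A) * (2 * t') * A^3 := by gcongr
        _ = 8 * (t' * A^4) := by ring
        _ ≤ 12 := by linarith
    have b3 : ((3:ℝ) * 18^n)^3 ≤ A^3 := by gcongr
    calc (5408 * (1 + t))^n * (p * W) ≤ (18^3)^n * (12 / A^3) := by gcongr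
      _ ≤ (18^3)^n * (12 / (3 * 18^n)^3) := by gcongr
      _ = 12/27 := by
        rw [mul_pow, ← pow_mul, ← pow_mul, mul_comm n 3]; field_simp; norm_num
      _ < 1/2 := by norm_num
  linarith

lemma choose_n (A : ℝ) (hA : 54 * 18^4 ≤ A) : ∃ n : ℕ, 54 * 18^n ≤ A ∧ A < 50 * 41^n := by
  have hex : ∃ m : ℕ, A < 54 * 18^m := by
    obtain ⟨m, hm⟩ := pow_unbounded_of_one_lt A (by norm_num : (1:ℝ) < 18)
    exact ⟨m, by linarith [pow_pos (by norm_num : (0:ℝ) < 18) m]⟩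
  classical
  obtain ⟨m, hm, hmin⟩ : ∃ m, A < 54 * 18^m ∧ ∀ k < m, ¬ A < 54 * 18^k :=
    ⟨Nat.find hex, Nat.find_spec hex, fun k hk => Nat.find_min hex hk⟩
  have hm4 : 4 < m := by
    by_contra h; push Not at h
    have : (18:ℝ)^m ≤ 18^4 := pow_le_pow_right₀ (by norm_num) h
    linarith
  obtain ⟨d, rfl⟩ : ∃ d, m = d + 5 := ⟨m - 5, by omega⟩
  refine ⟨d + 4, not_lt.1 (hmin _ (by omega)), hm.trans_le ?_⟩
  have : (18:ℝ)^d ≤ 41^d := by gcongr; norm_num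
  rw [pow_add, pow_add]
  have : (0:ℝ) < 41^d := by positivity
  nlinarith

lemma thue (γ : GaussianInt) (σ : ℤ) (hσ : σ = 1 ∨ σ = -1)
    (h : γ^4 + ⟨0,1⟩ * (star γ)^4 = (σ : GaussianInt) * ⟨1,1⟩) :
    ‖GaussianInt.toComplex γ‖ < 54 * 18^4 := by
  by_contra hA
  push Not at hA
  set g : ℂ := GaussianInt.toComplex γ with hg
  set A := ‖g‖ with hAdef
  obtain ⟨n, hn1, hn2⟩ := choose_n A hA
  have hA0 : 0 < A := by linarith [show (0:ℝ) < 54 * 18^4 by norm_num]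
  have hg0 : g ≠ 0 := by rw [← norm_pos_iff]; exact hA0
  have hσc : ‖(σ : ℂ)‖ = 1 := by rcases hσ with rfl | rfl <;> simp
  have hc : g^4 + I * (conj g)^4 = σ * (1 + I) := by
    have := congrArg GaussianInt.toComplex h
    simp only [map_add, map_mul, map_pow, map_intCast, GaussianInt.toComplex_star,
      GaussianInt.toComplex_def'] at this
    push_cast at this
    linear_combination this
  set k : ℂ := 3 + 2 * I with hk
  have hkn : ‖k‖^2 = 13 := norm_g0
  have hk0 : k ≠ 0 := by
    intro h0; rw [h0] at hkn; norm_num at hkn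
  have hck : conj k = 3 - 2 * I := by simp [hk, map_ofNat]; ring
  set x : ℂ := (1 + I) / k^4 with hx
  set x' : ℂ := σ * (1 + I) / g^4 with hx'
  have hI := norm_1I
  have hxt : ‖x‖^2 = 2 / 28561 := by
    rw [hx, norm_div, div_pow, hI, norm_pow, ← pow_mul, show 4 * 2 = 2 * 4 by norm_num, pow_mul, hkn]
    norm_num
  have hxt' : ‖x'‖ * A^4 ≤ 3/2 := by
    rw [hx', norm_div, norm_mul, hσc, one_mul, norm_pow, div_mul_cancel₀ _ (by positivity)]
    nlinarith [norm_nonneg (1 + I)]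
  have hx1 : ‖x‖ < 1 := by nlinarith [norm_nonneg x]
  have hx1' : ‖x'‖ < 1 := by
    have h3 : (3:ℝ) ≤ A := le_trans (by norm_num) hA
    have : (3:ℝ)^4 ≤ A^4 := by gcongr
    nlinarith [norm_nonneg x']
  obtain ⟨w, hw4, -, hwR⟩ := key x hx1
  obtain ⟨w', hw4', hw1', -⟩ := key x' hx1'
  have hT : w^4 * k^4 = -I * (conj k)^4 := by
    rw [hw4, hx, sub_mul, div_mul_cancel₀ _ (pow_ne_zero _ hk0), hck, hk]
    ring_nf
    simp only [show I^5 = I from by rw [show I^5 = I^4 * I by ring, I_pow_four]; ring, I_pow_four, I_pow_three, I_sq]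
    ring
  have hT' : w'^4 * g^4 = -I * (conj g)^4 := by
    rw [hw4', hx', sub_mul, div_mul_cancel₀ _ (pow_ne_zero _ hg0)]
    linear_combination hc
  have h4 : (w * (k * conj g))^4 = (w' * (g * conj k))^4 := by
    linear_combination (conj g)^4 * hT - (conj k)^4 * hT'
  obtain ⟨u, hu, hun⟩ := roots4 _ _ h4
  set uc := GaussianInt.toComplex u with huc
  set q : ℂ := k * conj g with hq
  set p : ℂ := uc * (g * conj k) with hp
  have hkn4 : ‖k‖ ≤ 4 := by nlinarith [norm_nonneg k]
  have hqn : ‖q‖ ≤ 4 * A := by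
    rw [hq, norm_mul, RCLike.norm_conj]; gcongr
  have hpn : ‖p‖ ≤ 4 * A := by
    rw [hp, norm_mul, norm_mul, RCLike.norm_conj, hun, one_mul, mul_comm]; gcongr
  have hq0 : q ≠ 0 := mul_ne_zero hk0 (by simpa using hg0)
  have hqw : q * w = p * w' := by
    rw [hp]; linear_combination hu
  have step : ∀ m : ℕ, 3 * 18^m ≤ A → A < 50 * 41^m →
      q * HC (-(1/4)) m x = p * HC (1/4) m x := by
    intro m hm1 hm2
    obtain ⟨P, hP⟩ := integral_HC (-1) m
    obtain ⟨Q, hQ⟩ := integral_HC 1 m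
    rw [show (((-1:ℤ):ℝ)/4) = -(1/4) by norm_num] at hP
    rw [show (((1:ℤ):ℝ)/4) = (1/4) by norm_num] at hQ
    rw [← hk, ← hx] at hP hQ
    have hz : (⟨3,2⟩ : GaussianInt) * star γ * P - u * (γ * star ⟨3,2⟩) * Q = 0 := by
      apply small_gauss
      have e : GaussianInt.toComplex ((⟨3,2⟩ : GaussianInt) * star γ * P - u * (γ * star ⟨3,2⟩) * Q)
          = q * (8^m * (k^4)^m * (HC (-(1/4)) m x - w * HC (1/4) m x))
            + 8^m * (k^4)^m * HC (1/4) m x * p * (w' - 1) := by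
        have e1 : GaussianInt.toComplex ((⟨3,2⟩ : GaussianInt) * star γ * P - u * (γ * star ⟨3,2⟩) * Q)
          = q * GaussianInt.toComplex P - p * GaussianInt.toComplex Q := by
          simp only [map_sub, map_mul, GaussianInt.toComplex_star, GaussianInt.toComplex_def']
          push_cast
          rw [hq, hp, hk]
        rw [e1, hP, hQ]
        linear_combination (8^m * (k^4)^m * HC (1/4) m x) * hqw
      rw [e]
      have hk4 : ‖(8^m * (k^4)^m : ℂ)‖ = 8^m * 169^m := by
        rw [norm_mul, norm_pow, norm_pow, norm_pow, show ‖k‖^4 = (‖k‖^2)^2 by ring, hkn]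
        norm_num
      refine lt_of_le_of_lt ?_ (est m A ‖x‖ ‖q‖ ‖p‖ ‖x'‖ ‖w' - 1‖ hm1 hm2 (norm_nonneg _) hxt
        (norm_nonneg _) hqn (norm_nonneg _) hpn (norm_nonneg _) hxt' hw1' (norm_nonneg _))
      refine (norm_add_le _ _).trans (add_le_add ?_ ?_)
      · rw [norm_mul q, norm_mul (8^m * (k^4)^m), hk4]
        gcongr
        exact hwR m
      · rw [norm_mul _ (w' - 1), norm_mul _ p, norm_mul (8^m * (k^4)^m), hk4]
        gcongr
        exact HC_bd m x
    have := congrArg GaussianInt.toComplex hz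
    have e1 : GaussianInt.toComplex ((⟨3,2⟩ : GaussianInt) * star γ * P - u * (γ * star ⟨3,2⟩) * Q)
          = q * GaussianInt.toComplex P - p * GaussianInt.toComplex Q := by
          simp only [map_sub, map_mul, GaussianInt.toComplex_star, GaussianInt.toComplex_def']
          push_cast
          rw [hq, hp, hk]
    rw [e1, hP, hQ, map_zero] at this
    have hne : (8^m * (k^4)^m : ℂ) ≠ 0 := mul_ne_zero (pow_ne_zero _ (by norm_num)) (pow_ne_zero _ (pow_ne_zero _ hk0))
    apply mul_left_cancel₀ hne
    linear_combination this
  have p18 : (0:ℝ) < 18^n := by positivity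
  have p41 : (0:ℝ) < 41^n := by positivity
  have s1 := step n (by linarith) hn2
  have s2 := step (n+1) (by rw [pow_succ]; linarith) (by rw [pow_succ]; linarith)
  have hdet := HC_det n x
  have hz : q * (((kap n : ℝ) : ℂ) * x ^ (2 * n + 1)) = 0 := by
    rw [← hdet]
    linear_combination HC (1/4) (n+1) x * s1 - HC (1/4) n x * s2
  have hx0 : x ≠ 0 := by
    intro h0; rw [h0] at hxt; norm_num at hxt
  have : ((kap n : ℝ) : ℂ) ≠ 0 := by exact_mod_cast (kap_pos n).ne'
  exact (mul_ne_zero hq0 (mul_ne_zero this (pow_ne_zero _ hx0))) hz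

end Ljung

namespace Ljung

/-- real part plus imaginary part -/
def LL (x : GaussianInt) : ℤ := x.re + x.im

lemma LL_add (x y : GaussianInt) : LL (x + y) = LL x + LL y := by
  simp [LL]; ring

lemma LL_int (d : ℤ) (y : GaussianInt) : LL ((d : GaussianInt) * y) = d * LL y := by
  simp [LL]; ring

lemma gi_eq (a b : ℤ) : (⟨a, b⟩ : GaussianInt) = (a : GaussianInt) + (b : GaussianInt) * ⟨0,1⟩ := by
  ext <;> simp

lemma I2 : (⟨0,1⟩ : GaussianInt)^2 = -1 := by
  rw [pow_two]; ext <;> simp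

lemma unit_cases (u : GaussianInt) (h : IsUnit u) : u = 1 ∨ u = -1 ∨ u = ⟨0,1⟩ ∨ u = ⟨0,-1⟩ := by
  have h1 : u.norm = 1 := by
    have := Zsqrtd.norm_eq_one_iff.2 h
    have h2 := GaussianInt.norm_nonneg u
    omega
  obtain ⟨a, b⟩ := u
  rw [Zsqrtd.norm_def] at h1
  simp only at h1
  have ha : a ≤ 1 := by nlinarith [mul_self_nonneg b]
  have ha' : -1 ≤ a := by nlinarith [mul_self_nonneg b]
  have hb : b ≤ 1 := by nlinarith [mul_self_nonneg a]
  have hb' : -1 ≤ b := by nlinarith [mul_self_nonneg a]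
  interval_cases a <;> interval_cases b <;> simp_all [Zsqrtd.ext_iff]

lemma fact (y : ℤ) (Z n : ℕ) (hn : 0 < n) (hZ : 0 < Z) (h : y^2 + 1 = 2 * (Z:ℤ)^n) :
    ∃ β u γ : GaussianInt, IsUnit u ∧ β = u * γ^n ∧ γ.norm = Z ∧ LL β = 1 ∧
      β + ⟨0,1⟩ * star β = ⟨1,1⟩ := by
  have hodd : y % 2 = 1 := by
    rcases Int.emod_two_eq_zero_or_one y with h0 | h0
    · exfalso
      obtain ⟨t, rfl⟩ := Int.dvd_of_emod_eq_zero h0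
      have : (2:ℤ) * (Z^n - 2 * t^2) = 1 := by linear_combination -h
      omega
    · exact h0
  obtain ⟨t, rfl⟩ : ∃ t, y = 2 * t + 1 := ⟨y / 2, by omega⟩
  have hN : 2 * t^2 + 2 * t + 1 = (Z:ℤ)^n := by linarith
  set β : GaussianInt := ⟨t+1, -t⟩ with hβ
  have hm : β * star β = (Z : GaussianInt)^n := by
    have : (Z : GaussianInt)^n = (((Z:ℤ)^n : ℤ) : GaussianInt) := by push_cast; rfl
    rw [this, ← hN, pow_two]
    ext <;> simp [hβ] <;> ring
  have hcop : IsCoprime β (star β) := by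
    refine ⟨star β - ((t * (t+1) : ℤ) : GaussianInt) * ⟨1,-1⟩, -((t * (t+1) : ℤ) : GaussianInt) * ⟨1,1⟩, ?_⟩
    ext <;> simp [hβ] <;> ring
  obtain ⟨γ, u, hu⟩ := exists_associated_pow_of_mul_eq_pow' hcop hm
  have hnorm : γ.norm = Z := by
    have h1 : β.norm = (Z:ℤ)^n := by
      rw [← hN, Zsqrtd.norm_def]; simp [hβ]; ring
    have h2 : (u : GaussianInt).norm = 1 := by
      have := Zsqrtd.norm_eq_one_iff.2 u.isUnit
      have h2 := GaussianInt.norm_nonneg (u : GaussianInt)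
      omega
    have h3 : (γ.norm)^n = (Z:ℤ)^n := by
      rw [← h1, ← hu, Zsqrtd.norm_mul, h2, mul_one]
      exact (map_pow Zsqrtd.normMonoidHom γ n).symm
    exact (pow_left_inj₀ (GaussianInt.norm_nonneg γ) (by positivity) hn.ne').1 h3
  refine ⟨β, u, γ, u.isUnit, by rw [← hu, mul_comm], hnorm, by simp [LL, hβ], ?_⟩
  ext <;> simp [hβ]

lemma norm_bd (γ : GaussianInt) (h : ‖GaussianInt.toComplex γ‖ < 54 * 18^4) :
    γ.norm < 33000000000000 := by
  have h2 : (γ.norm : ℝ) = Complex.normSq (GaussianInt.toComplex γ) := GaussianInt.intCast_real_norm γ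
  rw [Complex.normSq_eq_norm_sq] at h2
  have h0 := norm_nonneg (GaussianInt.toComplex γ)
  have : (γ.norm : ℝ) < (33000000000000 : ℤ) := by
    rw [h2]; push_cast
    nlinarith
  exact_mod_cast this

lemma four_bd (y : ℤ) (Z : ℕ) (hZ : 0 < Z) (h : y^2 + 1 = 2 * (Z:ℤ)^4) : Z < 33000000000000 := by
  obtain ⟨β, u, γ, hu, hβ, hn, -, hb⟩ := fact y Z 4 (by norm_num) hZ h
  have hs : (star γ).norm = Z := by rw [Zsqrtd.norm_conj, hn]
  have key : ∀ δ : GaussianInt, δ.norm = Z → ∀ σ : ℤ, (σ = 1 ∨ σ = -1) →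
      δ^4 + ⟨0,1⟩ * (star δ)^4 = (σ : GaussianInt) * ⟨1,1⟩ → Z < 33000000000000 := by
    intro δ hδ σ hσ h
    have := norm_bd δ (thue δ σ hσ h)
    omega
  have hI := I2
  rw [hβ, star_mul, star_pow] at hb
  rcases unit_cases u hu with rfl | rfl | rfl | rfl
  · refine key γ hn 1 (Or.inl rfl) ?_
    rw [← hb]; simp
  · refine key γ hn (-1) (Or.inr rfl) ?_
    rw [← hb]; simp; ring
  · refine key (star γ) hs 1 (Or.inl rfl) ?_
    have e : star (⟨0,1⟩ : GaussianInt) = - ⟨0,1⟩ := by ext <;> simp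
    rw [e] at hb
    rw [← hb, star_star]; push_cast
    linear_combination (star γ)^4 * hI
  · refine key (star γ) hs (-1) (Or.inr rfl) ?_
    have e : star (⟨0,-1⟩ : GaussianInt) = ⟨0,1⟩ := by ext <;> simp
    have e' : (⟨0,-1⟩ : GaussianInt) = -⟨0,1⟩ := by ext <;> simp
    rw [e, e'] at hb
    rw [← hb, star_star]; push_cast
    linear_combination (star γ)^4 * hI

/-- solutions of the Pell equation `y ^ 2 + 1 = 2 * s ^ 2` -/
def PP : ℕ → ℕ × ℕ
  | 0 => (1, 1)
  | j+1 => (3 * (PP j).1 + 4 * (PP j).2, 2 * (PP j).1 + 3 * (PP j).2)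

lemma pell (s : ℕ) : ∀ y : ℕ, y^2 + 1 = 2 * s^2 → ∃ j, PP j = (y, s) := by
  induction s using Nat.strong_induction_on with
  | _ s ih =>
    intro y h
    rcases Nat.lt_or_ge s 2 with hs | hs
    · interval_cases s
      · omega
      · refine ⟨0, ?_⟩
        have : y = 1 := by nlinarith
        rw [this]; rfl
    · have h1 : 4 * s ≤ 3 * y := by nlinarith
      have h2 : 2 * y ≤ 3 * s := by nlinarith
      have h3 : s < y := by nlinarith
      obtain ⟨p, hp⟩ := Nat.exists_eq_add_of_le h1
      obtain ⟨r, hr⟩ := Nat.exists_eq_add_of_le h2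
      have hy : y = 3 * p + 4 * r := by omega
      have hs' : s = 2 * p + 3 * r := by omega
      obtain ⟨j, hj⟩ := ih r (by omega) p (by subst hy hs'; nlinarith)
      exact ⟨j + 1, by rw [PP, hj, hy, hs']⟩

lemma PP_bd (j : ℕ) : (PP j).2 ≤ (PP j).1 ∧ 5^j ≤ (PP j).2 := by
  induction j with
  | zero => simp [PP]
  | succ j ih => rw [PP, pow_succ]; simp only; omega

lemma PP_sq : ∀ j < 39, (Nat.sqrt (PP j).2)^2 = (PP j).2 → j = 0 ∨ j = 3 := by
  intro j hj h
  interval_cases j <;> first | (left; rfl) | (right; rfl) | (exfalso; revert h; norm_num [PP])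

lemma four (y Z : ℕ) (hZ : 0 < Z) (h : y^2 + 1 = 2 * Z^4) : Z = 1 ∨ Z = 13 := by
  have hb := four_bd y Z hZ (by exact_mod_cast h)
  obtain ⟨j, hj⟩ := pell (Z^2) y (by rw [h]; ring)
  have hj2 : (PP j).2 = Z^2 := by rw [hj]
  have hlt : j < 39 := by
    by_contra hc
    push Not at hc
    have h1 : 5^39 ≤ 5^j := Nat.pow_le_pow_right (by norm_num) hc
    have h2 := (PP_bd j).2
    have h3 : Z^2 < 33000000000000^2 := by gcongr
    have h4 : 33000000000000^2 < 5^39 := by norm_num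
    omega
  rcases PP_sq j hlt (by rw [hj2, Nat.sqrt_eq']) with rfl | rfl
  · left
    simp [PP] at hj2
    nlinarith
  · right
    simp [PP] at hj2
    nlinarith

lemma sec_ord (x y : GaussianInt) (n : ℕ) : ∃ w, (x + y)^n = x^n + n * x^(n-1) * y + w * y^2 :=
  ⟨(Polynomial.powAddExpansion x y n).1, (Polynomial.powAddExpansion x y n).2⟩

lemma st3 (n : ℕ) (hn : n % 2 = 1) (ε σ b : ℤ) (hε : ε = 1 ∨ ε = -1) (hσ : σ = 1 ∨ σ = -1)
    (hb : 2 ∣ b) (h : LL (((ε : GaussianInt) + b * ⟨1,1⟩)^n) = σ) : b = 0 := by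
  obtain ⟨w, hw⟩ := sec_ord (ε : GaussianInt) (b * ⟨1,1⟩) n
  have e1 : (ε : GaussianInt)^n = (ε : GaussianInt) := by
    rcases hε with rfl | rfl
    · simp
    · push_cast; exact (Nat.odd_iff.2 hn).neg_one_pow
  have e2 : (ε : GaussianInt)^(n-1) = 1 := by
    rcases hε with rfl | rfl
    · simp
    · push_cast; exact (Nat.even_iff.2 (by omega)).neg_one_pow
  have e3 : (⟨1,1⟩ : GaussianInt)^2 = ((2:ℤ) : GaussianInt) * ⟨0,1⟩ := by
    rw [pow_two]; ext <;> simp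
  have e4 : ((ε : GaussianInt) + b * ⟨1,1⟩)^n = (ε : ℤ) * (1 : GaussianInt) + (((n * b : ℤ) : GaussianInt) * ⟨1,1⟩ +
      ((2 * b^2 : ℤ) : GaussianInt) * (⟨0,1⟩ * w)) := by
    rw [hw, e1, e2, mul_pow, e3]; push_cast; ring
  rw [e4, LL_add, LL_add, LL_int, LL_int, LL_int] at h
  set K := LL (⟨0,1⟩ * w)
  simp only [LL] at h
  obtain ⟨c, rfl⟩ := hb
  norm_num at h
  have h' : 4 * (c * (n + 2 * c * K)) = σ - ε := by linear_combination h
  have h0 : c * (n + 2 * c * K) = 0 := by omega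
  rcases mul_eq_zero.1 h0 with h1 | h1
  · rw [h1]; rfl
  · exfalso
    rw [mul_assoc] at h1
    omega

lemma EE (c : ℤ) (x δ' : GaussianInt) (hx : x^2 = ((32 * c^2 : ℤ) : GaussianInt) * δ') (t : ℕ) (s : ℕ) :
    ∃ w, (1 + x)^(2^s * t) = 1 + ((2^s * t : ℕ) : GaussianInt) * x + ((16 * c^2 * 2^s : ℤ) : GaussianInt) * w := by
  induction s with
  | zero =>
    obtain ⟨w, hw⟩ := sec_ord 1 x t
    refine ⟨2 * δ' * w, ?_⟩
    rw [pow_zero, one_mul, hw, hx]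
    push_cast
    simp
    ring
  | succ s ih =>
    obtain ⟨w, hw⟩ := ih
    refine ⟨(2^s * t^2) * δ' + w * (1 + ((2^s * t : ℕ) : GaussianInt) * x) + 8 * c^2 * 2^s * w^2, ?_⟩
    rw [show 2^(s+1) * t = (2^s * t) * 2 by ring, pow_mul, hw]
    push_cast at hx ⊢
    rw [pow_succ]
    linear_combination ((2:GaussianInt)^s * t)^2 * hx

lemma st1 (m : ℕ) (hm : 0 < m) (ε b : ℤ) (hε : ε = 1 ∨ ε = -1)
    (hb : 2 ∣ b) (h : LL (((ε : GaussianInt) + b * ⟨-1,1⟩)^(2*m+1)) = 1) : b = 0 := by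
  obtain ⟨c, rfl⟩ := hb
  set g : GaussianInt := (ε : GaussianInt) + ((2 * c : ℤ) : GaussianInt) * ⟨-1,1⟩ with hg
  set δ : GaussianInt := ⟨-ε, ε - 2 * c⟩ with hδ
  have hε2 : ε^2 = 1 := by rcases hε with rfl | rfl <;> norm_num
  have hg2 : g^2 = 1 + ((4 * c : ℤ) : GaussianInt) * δ := by
    rw [pow_two]
    ext <;> simp [hg, hδ]
    · linear_combination hε2
    · ring
  have hδ2 : δ^2 = 2 * ⟨2 * ε * c - 2 * c^2, -ε^2 + 2 * c * ε⟩ := by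
    rw [pow_two]
    ext <;> simp [hδ] <;> ring
  have hx : (((4 * c : ℤ) : GaussianInt) * δ)^2 = ((32 * c^2 : ℤ) : GaussianInt) *
      ⟨2 * ε * c - 2 * c^2, -ε^2 + 2 * c * ε⟩ := by
    rw [mul_pow, hδ2]; push_cast; ring
  obtain ⟨s, t, ht, rfl⟩ := Nat.exists_eq_two_pow_mul_odd hm.ne'
  obtain ⟨w, hw⟩ := EE c _ _ hx t s
  have e : g^(2*(2^s*t)+1) = g + (((2^s * t * (4 * c) : ℤ) : GaussianInt) * (g * δ)
      + ((16 * c^2 * 2^s : ℤ) : GaussianInt) * (g * w)) := by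
    rw [pow_succ, pow_mul, hg2, hw]; push_cast; ring
  have hL1 : LL g = ε := by simp [LL, hg]
  have hL2 : LL (g * δ) = -6 * ε * c + 8 * c^2 := by
    simp [LL, hg, hδ]; ring
  rw [e, LL_add g, hL1, LL_add, LL_int, LL_int, hL2] at h
  set K := LL (g * w)
  have h1 : 8 * (c^2 * 2^s * (t * (-3 * ε + 4 * c) + 2 * K)) = 1 - ε := by
    linear_combination h
  have h2 : c^2 * 2^s * (t * (-3 * ε + 4 * c) + 2 * K) = 0 := by omega
  have hε1 : ε = 1 := by omega
  rcases mul_eq_zero.1 h2 with h3 | h3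
  · rcases mul_eq_zero.1 h3 with h4 | h4
    · simp at h4; rw [h4]; rfl
    · exact absurd h4 (by positivity)
  · exfalso
    obtain ⟨r, rfl⟩ := ht
    rw [hε1] at h3
    push_cast at h3
    have : 2 * (-3 * r + 4 * c * r + 2 * c + K - 2) = (-1 : ℤ) := by linear_combination h3
    omega

lemma dvd_LL (g : GaussianInt) (d b : ℤ) (x : GaussianInt) (n : ℕ) (hg : g = d + b * x)
    (hx : LL (x^n) = 0) (h : LL (g^n) = 1) : d = 1 ∨ d = -1 := by
  obtain ⟨w, hw⟩ := sub_dvd_pow_sub_pow g (b * x) n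
  have e : g^n = ((b^n : ℤ) : GaussianInt) * x^n + (d : GaussianInt) * w := by
    rw [show g - b * x = d by rw [hg]; ring] at hw
    push_cast
    rw [← mul_pow]
    linear_combination hw
  rw [e, LL_add, LL_int, LL_int, hx, mul_zero, zero_add] at h
  exact Int.eq_one_or_neg_one_of_mul_eq_one h

lemma unit_pow (u : GaussianInt) (hu : IsUnit u) (n : ℕ) (hn : n % 2 = 1) : (u^n)^n = u := by
  have h4 : u^4 = 1 := by
    have e : u^4 = (u^2)^2 := by ring
    have hI := I2
    rcases unit_cases u hu with rfl | rfl | rfl | rfl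
    · simp
    · norm_num
    · rw [e, hI]; norm_num
    · rw [show (⟨0,-1⟩ : GaussianInt) = -⟨0,1⟩ by ext <;> simp, e] at *
      rw [neg_sq, hI]; norm_num
  obtain ⟨m, rfl⟩ : ∃ m, n = 2 * m + 1 := ⟨n / 2, by omega⟩
  rw [← pow_mul, show (2*m+1)*(2*m+1) = 4 * (m*m+m) + 1 by ring, pow_succ, pow_mul, h4]
  simp

lemma I_pow (n : ℕ) : (n % 4 = 1 → (⟨0,1⟩ : GaussianInt)^n = ⟨0,1⟩) ∧
    (n % 4 = 3 → (⟨0,1⟩ : GaussianInt)^n = ⟨0,-1⟩) := by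
  have h4 : (⟨0,1⟩ : GaussianInt)^4 = 1 := by
    rw [show 4 = 2 * 2 by norm_num, pow_mul, I2]; norm_num
  constructor
  · intro h
    obtain ⟨m, rfl⟩ : ∃ m, n = 4 * m + 1 := ⟨n / 4, by omega⟩
    rw [pow_succ, pow_mul, h4]; simp
  · intro h
    obtain ⟨m, rfl⟩ : ∃ m, n = 4 * m + 3 := ⟨n / 4, by omega⟩
    rw [pow_add, pow_mul, h4]
    rw [show 3 = 2 + 1 by norm_num, pow_succ _ 2, I2]; ext <;> simp

lemma stormer (y : ℤ) (Z n : ℕ) (hn : n % 2 = 1) (hn3 : 3 ≤ n) (hZ : 0 < Z)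
    (h : y^2 + 1 = 2 * (Z:ℤ)^n) : Z = 1 := by
  obtain ⟨β, u, γ₀, hu, hβ, hnm, hL, -⟩ := fact y Z n (by omega) hZ h
  obtain ⟨γ, hγ⟩ : ∃ γ, γ = u^n * γ₀ := ⟨_, rfl⟩
  have hL1 : LL (γ^n) = 1 := by
    rw [hγ, mul_pow, unit_pow u hu n hn, ← hβ, hL]
  have hγn : γ.norm = Z := by
    have h2 : (u^n : GaussianInt).norm = 1 := by
      have := Zsqrtd.norm_eq_one_iff.2 (hu.pow n)
      have h2 := GaussianInt.norm_nonneg (u^n : GaussianInt)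
      omega
    rw [hγ, Zsqrtd.norm_mul, h2, hnm, one_mul]
  clear hγ
  obtain ⟨a, b⟩ := γ
  have hsw : (⟨b, a⟩ : GaussianInt) = ⟨0,1⟩ * star ⟨a,b⟩ := by ext <;> simp
  have hN : a * a + b * b = Z := by
    rw [← hγn, Zsqrtd.norm_def]; simp
  obtain ⟨ε, hε, hab⟩ : ∃ ε : ℤ, (ε = 1 ∨ ε = -1) ∧ ((a + b = ε ∨ a - b = ε) ∧ (a = 0 ∨ b = 0)) := by
    rcases (by omega : n % 4 = 1 ∨ n % 4 = 3) with h4 | h4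
    · have e1 : (⟨a,b⟩ : GaussianInt) = ((a + b : ℤ) : GaussianInt) + b * ⟨-1,1⟩ := by
        ext <;> simp
      have e2 : (⟨b,a⟩ : GaussianInt) = ((a + b : ℤ) : GaussianInt) + a * ⟨-1,1⟩ := by
        ext <;> simp
      have hx : LL ((⟨-1,1⟩ : GaussianInt)^n) = 0 := by
        obtain ⟨m, rfl⟩ : ∃ m, n = 4 * m + 1 := ⟨n / 4, by omega⟩
        have : (⟨-1,1⟩ : GaussianInt)^4 = ((-4 : ℤ) : GaussianInt) := by
          rw [show 4 = 2 * 2 by norm_num, pow_mul, pow_two, pow_two]; ext <;> simp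
        rw [pow_succ, pow_mul, this, ← Int.cast_pow, LL_int]; simp [LL]
      have hε := dvd_LL _ _ _ _ n e1 hx hL1
      refine ⟨a + b, hε, Or.inl rfl, ?_⟩
      obtain ⟨m, rfl⟩ : ∃ m, n = 2 * m + 1 := ⟨n / 2, by omega⟩
      rcases (by omega : 2 ∣ b ∨ 2 ∣ a) with hb | hb
      · right
        rw [e1] at hL1
        exact st1 m (by omega) _ b hε hb hL1
      · left
        refine st1 m (by omega) _ a hε hb ?_
        rw [← e2, hsw, mul_pow, (I_pow _).1 h4, ← star_pow]
        refine Eq.trans ?_ hL1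
        generalize (⟨a,b⟩ : GaussianInt)^(2*m+1) = X
        simp [LL, add_comm]
    · have e1 : (⟨a,b⟩ : GaussianInt) = ((a - b : ℤ) : GaussianInt) + b * ⟨1,1⟩ := by
        ext <;> simp
      have e2 : (⟨b,a⟩ : GaussianInt) = ((b - a : ℤ) : GaussianInt) + a * ⟨1,1⟩ := by
        ext <;> simp
      have hx : LL ((⟨1,1⟩ : GaussianInt)^n) = 0 := by
        obtain ⟨m, rfl⟩ : ∃ m, n = 4 * m + 3 := ⟨n / 4, by omega⟩
        have : (⟨1,1⟩ : GaussianInt)^4 = ((-4 : ℤ) : GaussianInt) := by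
          rw [show 4 = 2 * 2 by norm_num, pow_mul, pow_two, pow_two]; ext <;> simp
        have h3 : (⟨1,1⟩ : GaussianInt)^3 = ⟨-2,2⟩ := by
          rw [pow_succ, pow_two]; ext <;> simp
        rw [pow_add, pow_mul, this, h3, ← Int.cast_pow, LL_int]; simp [LL]
      have hε := dvd_LL _ _ _ _ n e1 hx hL1
      refine ⟨a - b, hε, Or.inr rfl, ?_⟩
      rcases (by omega : 2 ∣ b ∨ 2 ∣ a) with hb | hb
      · right
        rw [e1] at hL1
        exact st3 n hn _ 1 b hε (Or.inl rfl) hb hL1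
      · left
        refine st3 n hn (b - a) (-1) a (by omega) (Or.inr rfl) hb ?_
        rw [← e2, hsw, mul_pow, (I_pow _).2 h4, ← star_pow]
        refine Eq.trans ?_ (congrArg Neg.neg hL1)
        generalize (⟨a,b⟩ : GaussianInt)^n = X
        simp [LL]
  have : (Z : ℤ) = 1 := by
    rw [← hN]
    rcases hab.2 with rfl | rfl
    · have : b = 1 ∨ b = -1 := by omega
      rcases this with rfl | rfl <;> norm_num
    · have : a = 1 ∨ a = -1 := by omega
      rcases this with rfl | rfl <;> norm_num
  exact_mod_cast this

lemma exp_cases (k : ℕ) (hk : 2 < k) : (∃ n d, n % 2 = 1 ∧ 3 ≤ n ∧ k = d * n) ∨ (∃ d, k = d * 4) := by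
  obtain ⟨s, t, ht, rfl⟩ := Nat.exists_eq_two_pow_mul_odd (by omega : k ≠ 0)
  have ht' := Nat.odd_iff.1 ht
  rcases (by omega : t = 1 ∨ 3 ≤ t) with rfl | h3
  · right
    rcases s with _ | _ | s
    · omega
    · omega
    · exact ⟨2^s, by ring⟩
  · left
    exact ⟨t, 2^s, ht', h3, rfl⟩

lemma main (y z k : ℕ) (hz : 0 < z) (hk : 2 < k)
    (heq : 2 * z ^ k = y ^ 2 + 1) :
    (y = 1 ∧ z = 1) ∨ (y = 239 ∧ z = 13 ∧ k = 4) := by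
  have one : z = 1 → (y = 1 ∧ z = 1) := by
    rintro rfl
    rw [one_pow] at heq
    refine ⟨?_, rfl⟩
    nlinarith
  rcases exp_cases k hk with ⟨n, d, hn, hn3, rfl⟩ | ⟨d, rfl⟩
  · left
    apply one
    have := stormer y (z^d) n hn hn3 (by positivity) (by
      rw [pow_mul] at heq; exact_mod_cast heq.symm)
    have hd : d ≠ 0 := by rintro rfl; omega
    exact (Nat.pow_eq_one.1 this).resolve_right hd
  · have hd : d ≠ 0 := by rintro rfl; omega
    rw [pow_mul] at heq
    rcases four y (z^d) (by positivity) heq.symm with h1 | h1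
    · left
      apply one
      exact (Nat.pow_eq_one.1 h1).resolve_right hd
    · right
      have hp : Nat.Prime (z^d) := by rw [h1]; norm_num
      have hd1 : d = 1 := Nat.Prime.eq_one_of_pow hp
      subst hd1
      rw [h1] at heq
      rw [pow_one] at h1
      exact ⟨by nlinarith, h1, rfl⟩

end Ljung

end

/-- Cohn: the equation `2z^k = y² + 1` with `k > 2` has only the positive integer
solutions `y = z = 1` and `y = 239, z = 13, k = 4`. -/
theorem cohn_two_zk_eq_sq_add_one
    (y z k : ℕ) (hy : 0 < y) (hz : 0 < z) (hk : 2 < k)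
    (heq : 2 * z ^ k = y ^ 2 + 1) :
    (y = 1 ∧ z = 1) ∨ (y = 239 ∧ z = 13 ∧ k = 4) := by
  exact Ljung.main y z k hz hk heq
end
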